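/- arXiv:2105.01684 — 2 statements merged into one kernel-verified Lean document; each statement's English description precedes it below -/
import Mathlib

section
/- If G is a graph with mad(G) < 8/3 and maximum degree Δ ≥ 4, then G is 2-distance (Δ+3)-choosable, i.e., for every list assignment L with |L(v)| ≥ Δ + 3 for all v, G admits a coloring φ with φ(v) ∈ L(v) in which any two vertices at distance at most 2 receive distinct colors. -/
open SimpleGraph

/-- Maximum average degree: the supremum over all nonempty subgraphs `H` of `2|E(H)|/|V(H)|`. -/
noncomputable def mad {V : Type} [Fintype V] (G : SimpleGraph V) : ℝ :=
  sSup {x : ℝ | ∃ H : G.Subgraph, H.verts.Nonempty ∧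
    x = 2 * H.edgeSet.ncard / H.verts.ncard}

/-- Two distinct vertices are at distance at most 2. -/
def TwoDistAdj {V : Type} (G : SimpleGraph V) (u v : V) : Prop :=
  u ≠ v ∧ (G.Adj u v ∨ ∃ w, G.Adj u w ∧ G.Adj w v)

/-- `φ` is a 2-distance coloring of `G` from the lists `L`: each vertex gets a color from
its list and vertices at distance at most 2 get distinct colors. -/
def IsTwoDistListColoring {V : Type} (G : SimpleGraph V) (L : V → Finset ℕ) (φ : V → ℕ) :
    Prop :=
  (∀ v, φ v ∈ L v) ∧ ∀ u v, TwoDistAdj G u v → φ u ≠ φ v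

namespace TwoDist

open Finset Classical

/-- Neighbourhood as a finset. -/
noncomputable def nb {V : Type} [Fintype V] (G : SimpleGraph V) (v : V) : Finset V :=
  univ.filter (fun w => G.Adj v w)

/-- Vertices at distance one or two. -/
noncomputable def N2 {V : Type} [Fintype V] (G : SimpleGraph V) (v : V) : Finset V :=
  univ.filter (fun w => TwoDistAdj G v w)

/-- Hereditary sparsity. -/
def Sparse {V : Type} [Fintype V] (G : SimpleGraph V) : Prop :=
  ∀ s : Finset V, s.Nonempty → 3 * ∑ v ∈ s, (s.filter (fun w => G.Adj v w)).card < 8 * s.card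

/-- `φ` is a proper list colouring outside `S`. -/
def POff {V : Type} (G : SimpleGraph V) (L : V → Finset ℕ) (φ : V → ℕ) (S : Finset V) : Prop :=
  (∀ v, v ∉ S → φ v ∈ L v) ∧ ∀ u v, u ∉ S → v ∉ S → TwoDistAdj G u v → φ u ≠ φ v

set_option linter.unusedSectionVars false

section basic
variable {V : Type} [Fintype V] {G : SimpleGraph V} {L : V → Finset ℕ} {φ : V → ℕ}

lemma mem_nb {v w : V} : w ∈ nb G v ↔ G.Adj v w := by simp [nb]

lemma mem_N2 {v w : V} : w ∈ N2 G v ↔ TwoDistAdj G v w := by simp [N2]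

lemma tda_symm {u v : V} (h : TwoDistAdj G u v) : TwoDistAdj G v u := by
  obtain ⟨h1, h2 | ⟨w, h2, h3⟩⟩ := h
  · exact ⟨h1.symm, Or.inl h2.symm⟩
  · exact ⟨h1.symm, Or.inr ⟨w, h3.symm, h2.symm⟩⟩

lemma tda_of_adj {u v : V} (h : G.Adj u v) : TwoDistAdj G u v := ⟨h.ne, Or.inl h⟩

lemma card_N2_le (v : V) : (N2 G v).card ≤ ∑ q ∈ nb G v, (nb G q).card := by
  have : N2 G v ⊆ (nb G v).biUnion (fun q => insert q ((nb G q).erase v)) := by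
    intro x hx
    rw [mem_N2] at hx
    obtain ⟨h1, h2 | ⟨w, h2, h3⟩⟩ := hx
    · simp only [mem_biUnion, mem_nb]
      exact ⟨x, h2, mem_insert_self _ _⟩
    · simp only [mem_biUnion, mem_nb]
      exact ⟨w, h2, mem_insert_of_mem (mem_erase.2 ⟨h1.symm, mem_nb.2 h3⟩)⟩
  refine (card_le_card this).trans (card_biUnion_le.trans (sum_le_sum ?_))
  intro q hq
  have hv : v ∈ nb G q := mem_nb.2 (mem_nb.1 hq).symm
  have h1 := card_insert_le q ((nb G q).erase v)
  rw [card_erase_of_mem hv] at h1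
  have : 0 < (nb G q).card := card_pos.2 ⟨v, hv⟩
  omega

lemma POff.mono {S T : Finset V} (h : POff G L φ S) (hST : S ⊆ T) : POff G L φ T :=
  ⟨fun v hv => h.1 v (fun h' => hv (hST h')),
   fun u v hu hv => h.2 u v (fun h' => hu (hST h')) (fun h' => hv (hST h'))⟩

/-- Available colours. -/
noncomputable def Av (G : SimpleGraph V) (L : V → Finset ℕ) (φ : V → ℕ) (S : Finset V) (v : V) :
    Finset ℕ := L v \ ((N2 G v \ S).image φ)

lemma card_Av {S T : Finset V} {v : V} {m k : ℕ} (hL : m ≤ (L v).card) (hk : (N2 G v).card ≤ k)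
    (hT : T ⊆ N2 G v) (hTS : T ⊆ S) : m + T.card ≤ (Av G L φ S v).card + k := by
  have h1 := le_card_sdiff ((N2 G v \ S).image φ) (L v)
  have h2 : ((N2 G v \ S).image φ).card ≤ (N2 G v \ S).card := card_image_le
  have h3 : (N2 G v \ S).card ≤ (N2 G v \ T).card := card_le_card (sdiff_subset_sdiff le_rfl hTS)
  have h4 : (N2 G v \ T).card = (N2 G v).card - T.card := card_sdiff_of_subset hT
  have h5 := card_le_card hT
  unfold Av
  omega

lemma extend {S : Finset V} (h : POff G L φ S) (c : V → ℕ)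
    (hc : ∀ v ∈ S, c v ∈ Av G L φ S v)
    (hcc : ∀ u ∈ S, ∀ v ∈ S, TwoDistAdj G u v → c u ≠ c v) :
    ∃ ψ, IsTwoDistListColoring G L ψ := by
  refine ⟨fun v => if v ∈ S then c v else φ v, ?_, ?_⟩
  · intro v
    by_cases hv : v ∈ S
    · simpa [hv] using (mem_sdiff.1 (hc v hv)).1
    · simpa [hv] using h.1 v hv
  · intro u v huv
    by_cases hu : u ∈ S <;> by_cases hv : v ∈ S <;> simp only [hu, hv, if_true, if_false]
    · exact hcc u hu v hv huv
    · intro he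
      apply (mem_sdiff.1 (hc u hu)).2
      exact mem_image.2 ⟨v, mem_sdiff.2 ⟨mem_N2.2 huv, hv⟩, he.symm⟩
    · intro he
      apply (mem_sdiff.1 (hc v hv)).2
      exact mem_image.2 ⟨u, mem_sdiff.2 ⟨mem_N2.2 (tda_symm huv), hu⟩, he⟩
    · exact h.2 u v hu hv huv

lemma greedy {S T : Finset V} {v : V} {m k : ℕ} (h : POff G L φ (insert v S))
    (hL : m ≤ (L v).card) (hk : (N2 G v).card ≤ k) (hT : T ⊆ N2 G v) (hTS : T ⊆ S)
    (hlt : k < m + T.card) : ∃ ψ, POff G L ψ S := by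
  have := card_Av (φ := φ) (S := insert v S) hL hk hT (hTS.trans (subset_insert _ _))
  obtain ⟨c, hc⟩ : (Av G L φ (insert v S) v).Nonempty := by
    rw [← card_pos]; omega
  have hc' := mem_sdiff.1 hc
  refine ⟨Function.update φ v c, ?_, ?_⟩
  · intro x hx
    by_cases hxv : x = v
    · subst hxv; simpa using hc'.1
    · simpa [hxv] using h.1 x (by simp [hx, hxv])
  · intro x y hx hy hxy
    by_cases hxv : x = v
    · subst hxv
      have hyx : y ≠ x := hxy.1.symm
      simp only [Function.update_self, Function.update_of_ne hyx]
      intro he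
      exact hc'.2 (mem_image.2 ⟨y, mem_sdiff.2 ⟨mem_N2.2 hxy, by simp [hy, hyx]⟩, he.symm⟩)
    · by_cases hyv : y = v
      · subst hyv
        simp only [Function.update_self, Function.update_of_ne hxv]
        intro he
        exact hc'.2 (mem_image.2 ⟨x, mem_sdiff.2 ⟨mem_N2.2 (tda_symm hxy), by simp [hx, hxv]⟩, he⟩)
      · simp only [Function.update_of_ne hxv, Function.update_of_ne hyv]
        exact h.2 x y (by simp [hx, hxv]) (by simp [hy, hyv]) hxy

lemma POff.done (h : POff G L φ ∅) : ∃ ψ, IsTwoDistListColoring G L ψ :=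
  ⟨φ, fun v => h.1 v (by simp), fun u v => h.2 u v (by simp) (by simp)⟩

end basic

/-! List colouring lemmas. -/

lemma exists_mem_not_mem {A B : Finset ℕ} (h : B.card < A.card) : ∃ a ∈ A, a ∉ B := by
  by_contra hc
  push Not at hc
  exact absurd (card_le_card hc) (by omega)

lemma pick {A : Finset ℕ} (B : Finset ℕ) {k : ℕ} (hA : k ≤ A.card) (hB : B.card < k) :
    ∃ a ∈ A, a ∉ B := exists_mem_not_mem (by omega)

lemma pick1 {A : Finset ℕ} (p : ℕ) (hA : 2 ≤ A.card) : ∃ a ∈ A, a ≠ p := by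
  obtain ⟨a, h, h'⟩ := pick {p} hA (by simp)
  exact ⟨a, h, by simpa using h'⟩

lemma pick2 {A : Finset ℕ} (p q : ℕ) (hA : 3 ≤ A.card) : ∃ a ∈ A, a ≠ p ∧ a ≠ q := by
  obtain ⟨a, h, h'⟩ := pick {p, q} hA (by have := card_le_two (a := p) (b := q); omega)
  exact ⟨a, h, by simpa using h'⟩

lemma pick3 {A : Finset ℕ} (p q r : ℕ) (hA : 4 ≤ A.card) : ∃ a ∈ A, a ≠ p ∧ a ≠ q ∧ a ≠ r := by
  obtain ⟨a, h, h'⟩ := pick {p, q, r} hA (by have := card_le_three (a := p) (b := q) (c := r); omega)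
  exact ⟨a, h, by simpa using h'⟩

/-- Removing an absent colour does not matter. -/
lemma listP {A B U W X : Finset ℕ} (hA : 3 ≤ A.card) (hB : 3 ≤ B.card) (hU : 4 ≤ U.card)
    (hW : 2 ≤ W.card) (hX : 2 ≤ X.card) :
    ∃ a ∈ A, ∃ b ∈ B, ∃ u ∈ U, ∃ w ∈ W, ∃ x ∈ X,
      a ≠ b ∧ a ≠ u ∧ a ≠ w ∧ b ≠ u ∧ b ≠ w ∧ u ≠ w ∧ x ≠ u ∧ x ≠ w := by
  obtain ⟨A, hAs, hA⟩ := exists_subset_card_eq hA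
  obtain ⟨B, hBs, hB⟩ := exists_subset_card_eq hB
  suffices ∃ a ∈ A, ∃ b ∈ B, ∃ u ∈ U, ∃ w ∈ W, ∃ x ∈ X,
      a ≠ b ∧ a ≠ u ∧ a ≠ w ∧ b ≠ u ∧ b ≠ w ∧ u ≠ w ∧ x ≠ u ∧ x ≠ w by
    obtain ⟨a, ha, b, hb, h⟩ := this
    exact ⟨a, hAs ha, b, hBs hb, h⟩
  by_cases h1 : W ⊆ A
  swap
  · obtain ⟨w, hw, hwA⟩ := not_subset.1 h1
    obtain ⟨x, hx, hxw⟩ := pick1 w hX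
    obtain ⟨b, hb, hbw⟩ := pick1 (A := B) w (by omega)
    obtain ⟨u, hu, hu1, hu2, hu3⟩ := pick3 w x b hU
    obtain ⟨a, ha, ha1, ha2⟩ := pick2 (A := A) b u (by omega)
    exact ⟨a, ha, b, hb, u, hu, w, hw, x, hx, by grind⟩
  by_cases h2 : W ⊆ B
  swap
  · obtain ⟨w, hw, hwA⟩ := not_subset.1 h2
    obtain ⟨x, hx, hxw⟩ := pick1 w hX
    obtain ⟨a, ha, haw⟩ := pick1 (A := A) w (by omega)
    obtain ⟨u, hu, hu1, hu2, hu3⟩ := pick3 w x a hU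
    obtain ⟨b, hb, hb1, hb2⟩ := pick2 (A := B) a u (by omega)
    exact ⟨a, ha, b, hb, u, hu, w, hw, x, hx, by grind⟩
  by_cases h3 : A ⊆ B
  · have hAB : A = B := eq_of_subset_of_card_le h3 (by omega)
    subst hAB
    obtain ⟨u, hu, huA⟩ := exists_mem_not_mem (A := U) (B := A) (by omega)
    obtain ⟨x, hx, hxu⟩ := pick1 u hX
    obtain ⟨w, hw, hwx⟩ := pick1 x hW
    obtain ⟨a, ha, haw⟩ := pick1 (A := A) w (by omega)
    obtain ⟨b, hb, hb1, hb2⟩ := pick2 (A := A) a w (by omega)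
    exact ⟨a, ha, b, hb, u, hu, w, hw, x, hx, by grind⟩
  · obtain ⟨a, ha, haB⟩ := not_subset.1 h3
    obtain ⟨w, hw, -⟩ := pick1 0 hW
    obtain ⟨x, hx, hxw⟩ := pick1 w hX
    obtain ⟨u, hu, hu1, hu2, hu3⟩ := pick3 w x a hU
    obtain ⟨b, hb, hb1, hb2⟩ := pick2 (A := B) u w (by omega)
    exact ⟨a, ha, b, hb, u, hu, w, hw, x, hx, by grind⟩

lemma listQ {A B U W X : Finset ℕ} (hA : 4 ≤ A.card) (hB : 3 ≤ B.card) (hU : 4 ≤ U.card)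
    (hW : 2 ≤ W.card) (hX : 3 ≤ X.card) :
    ∃ a ∈ A, ∃ b ∈ B, ∃ u ∈ U, ∃ w ∈ W, ∃ x ∈ X,
      a ≠ b ∧ a ≠ u ∧ a ≠ w ∧ b ≠ u ∧ b ≠ w ∧ u ≠ w ∧ x ≠ u ∧ x ≠ w ∧ x ≠ a := by
  by_cases hd : ∃ c, c ∈ B ∧ c ∈ X
  · obtain ⟨c, hcB, hcX⟩ := hd
    obtain ⟨w, hw, hwc⟩ := pick1 c hW
    obtain ⟨u, hu, hu1, hu2⟩ := pick2 (A := U) c w (by omega)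
    obtain ⟨a, ha, ha1, ha2, ha3⟩ := pick3 c w u hA
    exact ⟨a, ha, c, hcB, u, hu, w, hw, c, hcX, by grind⟩
  · obtain ⟨w, hw, -⟩ := pick1 0 hW
    by_cases hwB : w ∈ B
    · have hwX : w ∉ X := fun h => hd ⟨w, hwB, h⟩
      obtain ⟨b, hb, hb1⟩ := pick1 (A := B) w (by omega)
      obtain ⟨u, hu, hu1, hu2⟩ := pick2 (A := U) b w (by omega)
      obtain ⟨a, ha, ha1, ha2, ha3⟩ := pick3 b w u hA
      obtain ⟨x, hx, hx1, hx2⟩ := pick2 (A := X) u a hX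
      exact ⟨a, ha, b, hb, u, hu, w, hw, x, hx, by grind⟩
    · obtain ⟨x, hx, hx1⟩ := pick1 (A := X) w (by omega)
      obtain ⟨u, hu, hu1, hu2⟩ := pick2 (A := U) x w (by omega)
      obtain ⟨a, ha, ha1, ha2, ha3⟩ := pick3 x w u hA
      obtain ⟨b, hb, hb1, hb2⟩ := pick2 (A := B) u a hB
      exact ⟨a, ha, b, hb, u, hu, w, hw, x, hx, by grind⟩

/-- A minimal counterexample. -/
structure MinCE {V : Type} [Fintype V] (G : SimpleGraph V) (L : V → Finset ℕ) (D : ℕ) : Prop where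
  hD : 4 ≤ D
  deg : ∀ v, (nb G v).card ≤ D
  lst : ∀ v, D + 3 ≤ (L v).card
  red : ∀ S : Finset V, S.Nonempty →
    (∀ s ∈ S, ∀ a b, a ∉ S → b ∉ S → G.Adj s a → G.Adj s b → a = b) → ∃ φ, POff G L φ S
  non : ¬ ∃ ψ, IsTwoDistListColoring G L ψ

section red
variable {V : Type} [Fintype V] {G : SimpleGraph V} {L : V → Finset ℕ} {D : ℕ}

lemma nb_two {v a : V} (h : (nb G v).card = 2) (ha : G.Adj v a) : ∃ b, a ≠ b ∧ nb G v = {a, b} := by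
  obtain ⟨x, y, hxy, he⟩ := card_eq_two.1 h
  have : a ∈ nb G v := mem_nb.2 ha
  rw [he] at this
  simp only [mem_insert, mem_singleton] at this
  rcases this with rfl | rfl
  · exact ⟨y, hxy, he⟩
  · exact ⟨x, hxy.symm, by rw [he, pair_comm]⟩

lemma nb_three {v a b : V} (h : (nb G v).card = 3) (ha : G.Adj v a) (hb : G.Adj v b)
    (hab : a ≠ b) : ∃ c, a ≠ c ∧ b ≠ c ∧ nb G v = {a, b, c} := by
  have hs : ({a, b} : Finset V) ⊆ nb G v := by
    intro x hx
    simp only [mem_insert, mem_singleton] at hx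
    rcases hx with rfl | rfl <;> exact mem_nb.2 ‹_›
  have hc : (nb G v \ {a, b}).card = 1 := by
    rw [card_sdiff_of_subset hs, card_pair hab, h]
  obtain ⟨c, hc⟩ := card_eq_one.1 hc
  have h1 : c ∈ nb G v \ {a, b} := by simp [hc]
  simp only [mem_sdiff, mem_insert, mem_singleton, not_or] at h1
  refine ⟨c, Ne.symm h1.2.1, Ne.symm h1.2.2, ?_⟩
  rw [← sdiff_union_of_subset hs, hc]
  ext x; simp; tauto

lemma adj_iff_two {v a b : V} (h : nb G v = {a, b}) (x : V) : G.Adj v x ↔ x = a ∨ x = b := by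
  rw [← mem_nb, h]; simp

lemma adj_iff_three {v a b c : V} (h : nb G v = {a, b, c}) (x : V) :
    G.Adj v x ↔ x = a ∨ x = b ∨ x = c := by
  rw [← mem_nb, h]; simp

lemma card_N2_two {v a b : V} (h : nb G v = {a, b}) (hab : a ≠ b) :
    (N2 G v).card ≤ (nb G a).card + (nb G b).card := by
  have := card_N2_le (G := G) v
  rwa [h, sum_pair hab] at this

lemma card_N2_three {v a b c : V} (h : nb G v = {a, b, c}) (hab : a ≠ b) (hac : a ≠ c)
    (hbc : b ≠ c) : (N2 G v).card ≤ (nb G a).card + (nb G b).card + (nb G c).card := by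
  have := card_N2_le (G := G) v
  rw [h, sum_insert (by simp [hab, hac]), sum_pair hbc] at this
  omega

lemma MinCE.r0 (M : MinCE G L D) (v : V) : 2 ≤ (nb G v).card := by
  by_contra hlt
  push Not at hlt
  apply M.non
  have h1 : (nb G v).card ≤ 1 := by omega
  obtain ⟨φ, hφ⟩ := M.red {v} (by simp) (by
    intro s hs a b _ _ ha hb
    rw [mem_singleton] at hs
    subst hs
    exact card_le_one.1 h1 a (mem_nb.2 ha) b (mem_nb.2 hb))
  have h2 : (N2 G v).card ≤ D := by
    refine (card_N2_le v).trans ?_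
    refine (sum_le_card_nsmul _ _ D (fun q _ => M.deg q)).trans ?_
    simp only [smul_eq_mul]
    nlinarith
  obtain ⟨ψ, hψ⟩ := greedy (S := ∅) (T := ∅) (by simpa using hφ) (M.lst v) h2 (by simp) (by simp)
    (by simp)
  exact hψ.done

lemma MinCE.r1 (M : MinCE G L D) {u v : V} (hu : (nb G u).card = 2) (hv : (nb G v).card = 2) :
    ¬ G.Adj u v := by
  intro huv
  apply M.non
  obtain ⟨x, hx, hux⟩ := nb_two hu huv
  obtain ⟨y, hy, hvy⟩ := nb_two hv huv.symm
  obtain ⟨φ, hφ⟩ := M.red {u, v} (by simp) (by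
    intro s hs a b ha hb hsa hsb
    simp only [mem_insert, mem_singleton, not_or] at hs ha hb
    rcases hs with rfl | rfl
    · rw [adj_iff_two hux] at hsa hsb; grind
    · rw [adj_iff_two hvy] at hsa hsb; grind)
  have h1 := card_N2_two hux hx
  have h2 := card_N2_two hvy hy
  have := M.deg x
  have := M.deg y
  obtain ⟨φ1, h3⟩ := greedy (S := {v}) (T := ∅) hφ (M.lst u) h1 (by simp) (by simp)
    (by simp; omega)
  obtain ⟨φ2, h4⟩ := greedy (S := ∅) (T := ∅) (by simpa using h3) (M.lst v) h2 (by simp) (by simp)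
    (by simp; omega)
  exact h4.done

/-- Colouring of everything except a bad vertex and its two neighbours of degree two. -/
lemma MinCE.off3 (M : MinCE G L D) {u a b w a' b' : V} (hu : nb G u = {a, b, w})
    (ha : nb G a = {u, a'}) (hb : nb G b = {u, b'}) : ∃ φ, POff G L φ {a, b, u} := by
  apply M.red {a, b, u} (by simp)
  intro s hs p q hp hq hsp hsq
  simp only [mem_insert, mem_singleton, not_or] at hs hp hq
  rcases hs with rfl | rfl | rfl
  · rw [adj_iff_two ha] at hsp hsq; grind
  · rw [adj_iff_two hb] at hsp hsq; grind
  · rw [adj_iff_three hu] at hsp hsq; grind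

lemma MinCE.r2 (M : MinCE G L D) {u a b w a' b' : V} (hu : nb G u = {a, b, w})
    (ha : nb G a = {u, a'}) (hb : nb G b = {u, b'}) (hab : a ≠ b) (haw : a ≠ w) (hbw : b ≠ w)
    (ha' : u ≠ a') (hb' : u ≠ b') : D + 3 ≤ (N2 G u).card := by
  by_contra hlt
  apply M.non
  obtain ⟨φ, hφ⟩ := M.off3 hu ha hb
  have hua : G.Adj u a := (adj_iff_three hu a).2 (by simp)
  have hub : G.Adj u b := (adj_iff_three hu b).2 (by simp)
  have hu3 : (nb G u).card = 3 := by rw [hu]; exact card_eq_three.2 ⟨a, b, w, hab, haw, hbw, rfl⟩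
  have hTab : TwoDistAdj G a b := ⟨hab, Or.inr ⟨u, hua.symm, hub⟩⟩
  have h1 := card_N2_two ha ha'
  have h2 := card_N2_two hb hb'
  have := M.deg a'
  have := M.deg b'
  obtain ⟨φ1, h3⟩ := greedy (S := {b, u}) (T := {b, u}) hφ (M.lst a) h1
    (by intro x hx; simp only [mem_insert, mem_singleton] at hx
        rcases hx with rfl | rfl
        · exact mem_N2.2 hTab
        · exact mem_N2.2 (tda_of_adj hua.symm)) (by simp)
    (by rw [card_pair hub.ne']; omega)
  obtain ⟨φ2, h4⟩ := greedy (S := {u}) (T := {u}) h3 (M.lst b) h2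
    (by simpa using mem_N2.2 (tda_of_adj hub.symm)) (by simp) (by simp; omega)
  obtain ⟨φ3, h5⟩ := greedy (S := ∅) (T := ∅) (by simpa using h4) (M.lst u) le_rfl (by simp)
    (by simp) (by simp; omega)
  exact h5.done

set_option maxHeartbeats 4000000 in
lemma MinCE.r3 (M : MinCE G L D) {u a b w a' b' x y : V} (hu : nb G u = {a, b, w})
    (ha : nb G a = {u, a'}) (hb : nb G b = {u, b'}) (hw : nb G w = {u, x, y})
    (hab : a ≠ b) (haw : a ≠ w) (hbw : b ≠ w)
    (ha' : u ≠ a') (hb' : u ≠ b') (hux : u ≠ x) (huy : u ≠ y) (hxy : x ≠ y)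
    (hx7 : (N2 G x).card ≤ 7) (hw9 : (N2 G w).card ≤ 9)
    (hx : (nb G x).card = 2 ∨ ∀ z, G.Adj x z → z ≠ w → (nb G z).card = 2) : False := by
  have hua : G.Adj u a := (adj_iff_three hu a).2 (by simp)
  have hub : G.Adj u b := (adj_iff_three hu b).2 (by simp)
  have huw : G.Adj u w := (adj_iff_three hu w).2 (by simp)
  have hwx : G.Adj w x := (adj_iff_three hw x).2 (by simp)
  have hu3 : (nb G u).card = 3 := by rw [hu]; exact card_eq_three.2 ⟨a, b, w, hab, haw, hbw, rfl⟩
  have hw3 : (nb G w).card = 3 := by rw [hw]; exact card_eq_three.2 ⟨u, x, y, hux, huy, hxy, rfl⟩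
  have ha2 : (nb G a).card = 2 := by rw [ha]; exact card_pair ha'
  have hb2 : (nb G b).card = 2 := by rw [hb]; exact card_pair hb'
  have hN := M.r2 hu ha hb hab haw hbw ha' hb'
  have hN7 := card_N2_three hu hab haw hbw
  have hD : D = 4 := by have := M.hD; omega
  subst hD
  -- the distance-two neighbourhood of `u`
  have hsub : N2 G u ⊆ {a, b, w, a', b', x, y} := by
    intro z hz
    rw [mem_N2] at hz
    obtain ⟨h1, h2 | ⟨q, h2, h3⟩⟩ := hz
    · rw [adj_iff_three hu] at h2; simp; tauto
    · rw [adj_iff_three hu] at h2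
      rcases h2 with rfl | rfl | rfl
      · rw [adj_iff_two ha] at h3; simp; grind
      · rw [adj_iff_two hb] at h3; simp; grind
      · rw [adj_iff_three hw] at h3; simp; grind
  have hcard := card_le_card hsub
  have six : ∀ p q r s t z : V, ({a, b, w, a', b', x, y} : Finset V) ⊆ {p, q, r, s, t, z} →
      False := by
    intro p q r s t z h
    have h1 := card_le_card h
    have h2 := card_le_six (a := p) (b := q) (c := r) (d := s) (e := t) (f := z)
    omega
  have hxa : x ≠ a := by rintro rfl; exact six x b w a' b' y (by grind)
  have hxb : x ≠ b := by rintro rfl; exact six a x w a' b' y (by grind)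
  have haw' : a' ≠ w := by rintro rfl; exact six a b a' b' x y (by grind)
  have hbw' : b' ≠ w := by rintro rfl; exact six a b b' a' x y (by grind)
  have hab' : a' ≠ b' := by rintro rfl; exact six a b w a' x y (by grind)
  have hxw : x ≠ w := hwx.ne'
  have hTab : TwoDistAdj G a b := ⟨hab, Or.inr ⟨u, hua.symm, hub⟩⟩
  have hTaw : TwoDistAdj G a w := ⟨haw, Or.inr ⟨u, hua.symm, huw⟩⟩
  have hTbw : TwoDistAdj G b w := ⟨hbw, Or.inr ⟨u, hub.symm, huw⟩⟩
  have hTux : TwoDistAdj G u x := ⟨hux, Or.inr ⟨w, huw, hwx⟩⟩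
  have hTua := tda_of_adj hua
  have hTub := tda_of_adj hub
  have hTuw := tda_of_adj huw
  have hTwx := tda_of_adj hwx
  have haa' : G.Adj a a' := (adj_iff_two ha a').2 (by simp)
  have hbb' : G.Adj b b' := (adj_iff_two hb b').2 (by simp)
  have hnux : ¬ G.Adj u x := by rw [adj_iff_three hu]; grind
  -- conflicts between `x` and `a`
  have key : ∀ c c' : V, nb G c = {u, c'} → (nb G c).card = 2 → c' ≠ w → TwoDistAdj G c x →
      x = c' ∨ G.Adj x c' := by
    intro c c' hc _ _ h
    obtain ⟨-, h2 | ⟨q, h2, h3⟩⟩ := h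
    · rw [adj_iff_two hc] at h2; grind
    · rw [adj_iff_two hc] at h2
      rcases h2 with rfl | rfl
      · exact absurd h3 hnux
      · exact Or.inr h3.symm
  have hboth : ¬ (TwoDistAdj G a x ∧ TwoDistAdj G b x) := by
    rintro ⟨h1, h2⟩
    have h1 := key a a' ha ha2 haw' h1
    have h2 := key b b' hb hb2 hbw' h2
    rcases hx with hx | hx
    · obtain ⟨z, hz, hxz⟩ := nb_two hx hwx.symm
      rw [adj_iff_two hxz] at h1 h2
      have hxa' : x ≠ a' := by rintro rfl; exact M.r1 ha2 hx haa'
      have hxb' : x ≠ b' := by rintro rfl; exact M.r1 hb2 hx hbb'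
      grind
    · rcases h1 with h1 | h1
      · rcases h2 with h2 | h2
        · exact hab' (h1.symm.trans h2)
        · exact M.r1 hb2 (hx _ h2 hbw') hbb'
      · exact M.r1 ha2 (hx _ h1 haw') haa'
  obtain ⟨φ, hφ⟩ := M.off3 hu ha hb
  have hφ : POff G L φ {a, b, u, w, x} := hφ.mono (by grind)
  have hAu : 4 ≤ (Av G L φ {a, b, u, w, x} u).card := by
    have := card_Av (G := G) (φ := φ) (S := {a, b, u, w, x}) (T := {a, b, w, x}) (M.lst u)
      (k := 7) (by omega)
      (by intro z hz; simp only [mem_insert, mem_singleton] at hz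
          rcases hz with rfl | rfl | rfl | rfl <;> exact mem_N2.2 ‹_›)
      (by grind)
    have h4 : ({a, b, w, x} : Finset V).card = 4 := by
      rw [card_insert_of_notMem (by simp; grind), card_insert_of_notMem (by simp; grind),
        card_pair (by grind)]
    omega
  have hAw : 2 ≤ (Av G L φ {a, b, u, w, x} w).card := by
    have := card_Av (G := G) (φ := φ) (S := {a, b, u, w, x}) (T := {a, b, u, x}) (M.lst w) hw9
      (by intro z hz; simp only [mem_insert, mem_singleton] at hz
          rcases hz with rfl | rfl | rfl | rfl
          · exact mem_N2.2 (tda_symm hTaw)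
          · exact mem_N2.2 (tda_symm hTbw)
          · exact mem_N2.2 (tda_symm hTuw)
          · exact mem_N2.2 hTwx)
      (by grind)
    have h4 : ({a, b, u, x} : Finset V).card = 4 := by
      rw [card_insert_of_notMem (by simp; grind [G.ne_of_adj hua]),
        card_insert_of_notMem (by simp; grind [G.ne_of_adj hub]), card_pair (by grind)]
    omega
  have hAc : ∀ c c' d : V, nb G c = {u, c'} → u ≠ c' → c ∈ ({a, b} : Finset V) →
      d ∈ ({a, b} : Finset V) → c ≠ d →
      3 ≤ (Av G L φ {a, b, u, w, x} c).card ∧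
      (TwoDistAdj G c x → 4 ≤ (Av G L φ {a, b, u, w, x} c).card ∧
        3 ≤ (Av G L φ {a, b, u, w, x} x).card) := by
    intro c c' d hc hc' hcm hdm hcd
    have h7 := card_N2_two hc hc'
    have := M.deg c'
    simp only [mem_insert, mem_singleton] at hcm hdm
    have hTcd : TwoDistAdj G c d := by
      rcases hcm with rfl | rfl <;> rcases hdm with rfl | rfl
      · exact absurd rfl hcd
      · exact hTab
      · exact tda_symm hTab
      · exact absurd rfl hcd
    have hTuc : TwoDistAdj G u c := by rcases hcm with rfl | rfl <;> assumption
    have hTcw : TwoDistAdj G c w := by rcases hcm with rfl | rfl <;> assumption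
    have hdu : d ≠ u := by rcases hdm with rfl | rfl; exacts [hua.ne', hub.ne']
    have hdw : d ≠ w := by rcases hdm with rfl | rfl <;> assumption
    have hdx : d ≠ x := by rcases hdm with rfl | rfl; exacts [hxa.symm, hxb.symm]
    have huw' := huw.ne
    constructor
    · have := card_Av (G := G) (φ := φ) (S := {a, b, u, w, x}) (T := {d, u, w}) (M.lst c) (k := 7)
        (by omega)
        (by intro z hz; simp only [mem_insert, mem_singleton] at hz
            rcases hz with rfl | rfl | rfl
            · exact mem_N2.2 hTcd
            · exact mem_N2.2 (tda_symm hTuc)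
            · exact mem_N2.2 hTcw)
        (by intro z; simp; grind)
      rw [card_insert_of_notMem (by simp; grind), card_pair huw'] at this
      omega
    · intro hTcx
      constructor
      · have := card_Av (G := G) (φ := φ) (S := {a, b, u, w, x}) (T := {d, u, w, x}) (M.lst c) (k := 7)
          (by omega)
          (by intro z hz; simp only [mem_insert, mem_singleton] at hz
              rcases hz with rfl | rfl | rfl | rfl
              · exact mem_N2.2 hTcd
              · exact mem_N2.2 (tda_symm hTuc)
              · exact mem_N2.2 hTcw
              · exact mem_N2.2 hTcx)
          (by intro z; simp; grind)
        rw [card_insert_of_notMem (by simp; grind), card_insert_of_notMem (by simp; grind),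
          card_pair hxw.symm] at this
        omega
      · have := card_Av (G := G) (φ := φ) (S := {a, b, u, w, x}) (T := {c, u, w}) (M.lst x) hx7
          (by intro z hz; simp only [mem_insert, mem_singleton] at hz
              rcases hz with rfl | rfl | rfl
              · exact mem_N2.2 (tda_symm hTcx)
              · exact mem_N2.2 (tda_symm hTux)
              · exact mem_N2.2 (tda_symm hTwx))
          (by intro z; simp; grind)
        rw [card_insert_of_notMem (by simp; grind [hTuc.1, hTcw.1]), card_pair huw'] at this
        omega
  have hAx : 2 ≤ (Av G L φ {a, b, u, w, x} x).card := by
    have := card_Av (G := G) (φ := φ) (S := {a, b, u, w, x}) (T := {u, w}) (M.lst x) hx7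
      (by intro z hz; simp only [mem_insert, mem_singleton] at hz
          rcases hz with rfl | rfl
          · exact mem_N2.2 (tda_symm hTux)
          · exact mem_N2.2 (tda_symm hTwx))
      (by grind)
    rw [card_pair huw.ne] at this
    omega
  obtain ⟨hA1, hA2⟩ := hAc a a' b ha ha' (by simp) (by simp) hab
  obtain ⟨hB1, hB2⟩ := hAc b b' a hb hb' (by simp) (by simp) hab.symm
  -- finish from a suitable choice of colours
  have fin : ∀ ca ∈ Av G L φ {a, b, u, w, x} a, ∀ cb ∈ Av G L φ {a, b, u, w, x} b,
      ∀ cu ∈ Av G L φ {a, b, u, w, x} u, ∀ cw ∈ Av G L φ {a, b, u, w, x} w,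
      ∀ cx ∈ Av G L φ {a, b, u, w, x} x,
      ca ≠ cb → ca ≠ cu → ca ≠ cw → cb ≠ cu → cb ≠ cw → cu ≠ cw → cx ≠ cu → cx ≠ cw →
      (TwoDistAdj G a x → cx ≠ ca) → (TwoDistAdj G b x → cx ≠ cb) → False := by
    intro ca hca cb hcb cu hcu cw hcw cx hcx h1 h2 h3 h4 h5 h6 h7 h8 h9 h10
    apply M.non
    have nau := hua.ne'
    have nbu := hub.ne'
    have nuw := huw.ne
    let c : V → ℕ := fun z => if z = a then ca else if z = b then cb else if z = u then cu else
      if z = w then cw else cx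
    have ea : c a = ca := by simp [c]
    have eb : c b = cb := by simp [c, hab.symm]
    have eu : c u = cu := by simp [c, nau.symm, nbu.symm]
    have ew : c w = cw := by simp [c, nuw.symm, haw.symm, hbw.symm]
    have ex : c x = cx := by simp [c, hxa, hxb, hux.symm, hxw]
    refine extend hφ c ?_ ?_
    · intro z hz
      simp only [mem_insert, mem_singleton] at hz
      rcases hz with rfl | rfl | rfl | rfl | rfl
      · rwa [ea]
      · rwa [eb]
      · rwa [eu]
      · rwa [ew]
      · rwa [ex]
    · intro p hp q hq hpq
      simp only [mem_insert, mem_singleton] at hp hq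
      have hpq' := tda_symm hpq
      have hne := hpq.1
      rcases hp with hp | hp | hp | hp | hp <;> rcases hq with hq | hq | hq | hq | hq <;>
        rw [hp, hq] at hpq hpq' hne ⊢ <;> simp only [ea, eb, eu, ew, ex] <;>
        first
        | exact absurd rfl hne
        | assumption
        | (apply Ne.symm; assumption)
        | exact h9 hpq'
        | exact h10 hpq'
        | exact (h9 hpq).symm
        | exact (h10 hpq).symm
  by_cases hax : TwoDistAdj G a x
  · have hbx : ¬ TwoDistAdj G b x := fun h => hboth ⟨hax, h⟩
    obtain ⟨hA4, hX3⟩ := hA2 hax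
    obtain ⟨ca, hca, cb, hcb, cu, hcu, cw, hcw, cx, hcx, h1, h2, h3, h4, h5, h6, h7, h8, h9⟩ :=
      listQ hA4 hB1 hAu hAw hX3
    exact fin ca hca cb hcb cu hcu cw hcw cx hcx h1 h2 h3 h4 h5 h6 h7 h8 (fun _ => h9)
      (fun h => absurd h hbx)
  by_cases hbx : TwoDistAdj G b x
  · obtain ⟨hB4, hX3⟩ := hB2 hbx
    obtain ⟨cb, hcb, ca, hca, cu, hcu, cw, hcw, cx, hcx, h1, h2, h3, h4, h5, h6, h7, h8, h9⟩ :=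
      listQ hB4 hA1 hAu hAw hX3
    exact fin ca hca cb hcb cu hcu cw hcw cx hcx h1.symm h4 h5 h2 h3 h6 h7 h8
      (fun h => absurd h hax) (fun _ => h9)
  · obtain ⟨ca, hca, cb, hcb, cu, hcu, cw, hcw, cx, hcx, h1, h2, h3, h4, h5, h6, h7, h8⟩ :=
      listP hA1 hB1 hAu hAw hAx
    exact fin ca hca cb hcb cu hcu cw hcw cx hcx h1 h2 h3 h4 h5 h6 h7 h8
      (fun h => absurd h hax) (fun h => absurd h hbx)

end red

section discharge
variable {V : Type} [Fintype V] {G : SimpleGraph V} {L : V → Finset ℕ} {D : ℕ}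

/-- A vertex of degree three with two neighbours of degree two. -/
def Bad (G : SimpleGraph V) (v : V) : Prop :=
  (nb G v).card = 3 ∧ ∃ a b, a ≠ b ∧ G.Adj v a ∧ G.Adj v b ∧ (nb G a).card = 2 ∧ (nb G b).card = 2

/-- `u` sends one unit of charge to `v`. -/
def Give (G : SimpleGraph V) (u v : V) : Prop :=
  G.Adj u v ∧ (4 ≤ (nb G u).card ∨ ((nb G u).card = 3 ∧ (nb G v).card = 2) ∨
    ((nb G u).card = 3 ∧ Bad G v ∧ ∀ z, G.Adj u z → (nb G z).card ≠ 2))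

lemma bad_struct {v : V} (h : Bad G v) : ∃ a b w a' b', nb G v = {a, b, w} ∧ nb G a = {v, a'} ∧
    nb G b = {v, b'} ∧ a ≠ b ∧ a ≠ w ∧ b ≠ w ∧ v ≠ a' ∧ v ≠ b' ∧ (nb G a).card = 2 ∧
    (nb G b).card = 2 := by
  obtain ⟨h3, a, b, hab, hva, hvb, ha, hb⟩ := h
  obtain ⟨w, haw, hbw, hv⟩ := nb_three h3 hva hvb hab
  obtain ⟨a', ha', hna⟩ := nb_two ha hva.symm
  obtain ⟨b', hb', hnb⟩ := nb_two hb hvb.symm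
  exact ⟨a, b, w, a', b', hv, hna, hnb, hab, haw, hbw, ha', hb', ha, hb⟩

/-- The third neighbour of a bad vertex. -/
lemma MinCE.bad_third (M : MinCE G L D) {u a b w a' b' : V} (hu : nb G u = {a, b, w})
    (ha : nb G a = {u, a'}) (hb : nb G b = {u, b'}) (hab : a ≠ b) (haw : a ≠ w) (hbw : b ≠ w)
    (ha' : u ≠ a') (hb' : u ≠ b') :
    4 ≤ (nb G w).card ∨ ((nb G w).card = 3 ∧ D = 4 ∧ ∀ z, G.Adj w z → (nb G z).card ≠ 2) := by
  have h1 := M.r2 hu ha hb hab haw hbw ha' hb'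
  have h2 := card_N2_three hu hab haw hbw
  have ha2 : (nb G a).card = 2 := by rw [ha]; exact card_pair ha'
  have hb2 : (nb G b).card = 2 := by rw [hb]; exact card_pair hb'
  have hD := M.hD
  by_cases h4 : 4 ≤ (nb G w).card
  · exact Or.inl h4
  have h3 : (nb G w).card = 3 := by omega
  refine Or.inr ⟨h3, by omega, ?_⟩
  intro x hwx hx2
  have huw : G.Adj u w := (adj_iff_three hu w).2 (by simp)
  have hu3 : (nb G u).card = 3 := by rw [hu]; exact card_eq_three.2 ⟨a, b, w, hab, haw, hbw, rfl⟩
  have hux : u ≠ x := by rintro rfl; omega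
  obtain ⟨y, huy, hxy, hw⟩ := nb_three h3 huw.symm hwx hux
  obtain ⟨z, hwz, hxz⟩ := nb_two hx2 hwx.symm
  have e1 := card_N2_two hxz hwz
  have e2 := card_N2_three hw hux huy hxy
  have := M.deg z
  have := M.deg y
  exact M.r3 hu ha hb hw hab haw hbw ha' hb' hux huy hxy (by omega) (by omega) (Or.inl hx2)

/-- Two bad neighbours of a vertex of degree three. -/
lemma MinCE.two_bad (M : MinCE G L D) {w u x y : V} (hw : nb G w = {u, x, y})
    (hux : u ≠ x) (huy : u ≠ y) (hxy : x ≠ y) (hu : Bad G u) (hx : Bad G x)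
    (hno : ∀ z, G.Adj w z → (nb G z).card ≠ 2) : 4 ≤ (nb G y).card := by
  by_contra hy
  have hx3 := hx.1
  have hu3 := hu.1
  have hwu : G.Adj w u := (adj_iff_three hw u).2 (by simp)
  have hwx : G.Adj w x := (adj_iff_three hw x).2 (by simp)
  have hw3 : (nb G w).card = 3 := by rw [hw]; exact card_eq_three.2 ⟨u, x, y, hux, huy, hxy, rfl⟩
  obtain ⟨a, b, w1, a', b', h1, h2, h3, h4, h5, h6, h7, h8, ha2, hb2⟩ := bad_struct hu
  obtain ⟨c, d, w2, c', d', k1, k2, k3, k4, k5, k6, k7, k8, hc2, hd2⟩ := bad_struct hx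
  have e1 : w = w1 := by
    have := (adj_iff_three h1 w).1 hwu.symm
    rcases this with rfl | rfl | rfl
    · omega
    · omega
    · rfl
  have e2 : w = w2 := by
    have := (adj_iff_three k1 w).1 hwx.symm
    rcases this with rfl | rfl | rfl
    · omega
    · omega
    · rfl
  subst e1
  subst e2
  have n1 := card_N2_three k1 k4 k5 k6
  have n2 := card_N2_three hw hux huy hxy
  refine M.r3 h1 h2 h3 hw h4 h5 h6 h7 h8 hux huy hxy (by omega) (by omega) (Or.inr ?_)
  intro z hz hzw
  rcases (adj_iff_three k1 z).1 hz with rfl | rfl | rfl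
  · exact hc2
  · exact hd2
  · exact absurd rfl hzw

lemma MinCE.final (M : MinCE G L D) (v : V) :
    8 + (univ.filter (fun x => Give G v x)).card ≤
      3 * (nb G v).card + (univ.filter (fun x => Give G x v)).card := by
  have h2 := M.r0 v
  have hsub : (univ.filter (fun x => Give G v x)) ⊆ nb G v := by
    intro x hx
    simp only [mem_filter, mem_univ, true_and] at hx
    exact mem_nb.2 hx.1
  have hout := card_le_card hsub
  by_cases h4 : 4 ≤ (nb G v).card
  · omega
  by_cases hv2 : (nb G v).card = 2
  · have ho : (univ.filter (fun x => Give G v x)) = ∅ := by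
      rw [filter_eq_empty_iff]
      rintro x - ⟨-, h | h | h⟩ <;> omega
    have hi : nb G v ⊆ univ.filter (fun x => Give G x v) := by
      intro x hx
      have hx := mem_nb.1 hx
      have h2x := M.r0 x
      have h3x : (nb G x).card ≠ 2 := fun h => M.r1 hv2 h hx
      simp only [mem_filter, mem_univ, true_and]
      refine ⟨hx.symm, ?_⟩
      by_cases h : 4 ≤ (nb G x).card
      · exact Or.inl h
      · exact Or.inr (Or.inl ⟨by omega, hv2⟩)
    have := card_le_card hi
    rw [ho, card_empty]
    omega
  have hv3 : (nb G v).card = 3 := by omega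
  by_cases hbad : Bad G v
  · obtain ⟨a, b, w, a', b', h1, h2, h3, h4, h5, h6, h7, h8, ha2, hb2⟩ := bad_struct hbad
    have hva : G.Adj v a := (adj_iff_three h1 a).2 (by simp)
    have hvw : G.Adj v w := (adj_iff_three h1 w).2 (by simp)
    have hthird := M.bad_third h1 h2 h3 h4 h5 h6 h7 h8
    have hw2 : (nb G w).card ≠ 2 := by rcases hthird with h | h <;> omega
    have ho : (univ.filter (fun x => Give G v x)) ⊆ {a, b} := by
      intro x hx
      simp only [mem_filter, mem_univ, true_and] at hx
      obtain ⟨hx1, hx2⟩ := hx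
      rcases (adj_iff_three h1 x).1 hx1 with rfl | rfl | rfl
      · simp
      · simp
      · exfalso
        rcases hx2 with h | h | h
        · omega
        · exact hw2 h.2
        · exact h.2.2 a hva ha2
    have hi : {w} ⊆ univ.filter (fun x => Give G x v) := by
      rw [singleton_subset_iff]
      simp only [mem_filter, mem_univ, true_and]
      refine ⟨hvw.symm, ?_⟩
      rcases hthird with h | h
      · exact Or.inl h
      · exact Or.inr (Or.inr ⟨h.1, hbad, h.2.2⟩)
    have c1 := card_le_card ho
    have c2 := card_le_card hi
    rw [card_pair h4] at c1
    rw [card_singleton] at c2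
    omega
  by_cases hone : ∃ z, G.Adj v z ∧ (nb G z).card = 2
  · obtain ⟨z, hz, hz2⟩ := hone
    have ho : (univ.filter (fun x => Give G v x)) ⊆ {z} := by
      intro x hx
      simp only [mem_filter, mem_univ, true_and] at hx
      obtain ⟨hx1, h | h | h⟩ := hx
      · omega
      · by_contra hxz
        exact hbad ⟨hv3, x, z, by simpa using hxz, hx1, hz, h.2, hz2⟩
      · exact absurd hz2 (h.2.2 z hz)
    have c1 := card_le_card ho
    rw [card_singleton] at c1
    omega
  push Not at hone
  by_cases hc : (univ.filter (fun x => Give G v x)).card ≤ 1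
  · omega
  obtain ⟨u, hu, x, hx, hux⟩ := one_lt_card.1 (not_le.1 hc)
  have hgb : ∀ z, Give G v z → Bad G z := by
    rintro z ⟨hz, h | h | h⟩
    · omega
    · exact absurd h.2 (hone z hz)
    · exact h.2.1
  simp only [mem_filter, mem_univ, true_and] at hu hx
  obtain ⟨y, huy, hxy, hv⟩ := nb_three hv3 hu.1 hx.1 hux
  have hy := M.two_bad hv hux huy hxy (hgb u hu) (hgb x hx) hone
  have ho : (univ.filter (fun x => Give G v x)) ⊆ {u, x} := by
    intro z hz
    simp only [mem_filter, mem_univ, true_and] at hz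
    have hb := (hgb z hz).1
    rcases (adj_iff_three hv z).1 hz.1 with rfl | rfl | rfl
    · simp
    · simp
    · omega
  have hi : {y} ⊆ univ.filter (fun x => Give G x v) := by
    rw [singleton_subset_iff]
    simp only [mem_filter, mem_univ, true_and]
    exact ⟨((adj_iff_three hv y).2 (by simp)).symm, Or.inl hy⟩
  have c1 := card_le_card ho
  have c2 := card_le_card hi
  rw [card_pair hux] at c1
  rw [card_singleton] at c2
  omega

lemma MinCE.not_sparse [Nonempty V] (M : MinCE G L D) : ¬ Sparse G := by
  intro hs
  have h := hs univ univ_nonempty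
  have h1 : ∑ v : V, (8 + (univ.filter (fun x => Give G v x)).card) ≤
      ∑ v : V, (3 * (nb G v).card + (univ.filter (fun x => Give G x v)).card) :=
    sum_le_sum (fun v _ => M.final v)
  have h2 : ∑ v : V, (univ.filter (fun x => Give G v x)).card =
      ∑ v : V, (univ.filter (fun x => Give G x v)).card :=
    sum_card_bipartiteAbove_eq_sum_card_bipartiteBelow (Give G)
  rw [sum_add_distrib, sum_add_distrib, ← mul_sum, h2] at h1
  simp only [sum_const, smul_eq_mul] at h1
  unfold nb at h1
  omega

end discharge

theorem main (D : ℕ) (hD : 4 ≤ D) : ∀ (n : ℕ) (V : Type) [Fintype V] (G : SimpleGraph V)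
    (L : V → Finset ℕ), Fintype.card V = n → Sparse G → (∀ v, (nb G v).card ≤ D) →
    (∀ v, D + 3 ≤ (L v).card) → ∃ ψ, IsTwoDistListColoring G L ψ := by
  intro n
  induction n using Nat.strong_induction_on with
  | _ n ih =>
  intro V _ G L hn hsp hdeg hL
  by_contra hno
  rcases isEmpty_or_nonempty V with hV | hV
  · exact hno ⟨fun _ => 0, fun v => isEmptyElim v, fun v => isEmptyElim v⟩
  refine MinCE.not_sparse (G := G) (L := L) (D := D) ⟨hD, hdeg, hL, ?_, hno⟩ hsp
  intro S hS hone
  let f : {v // v ∉ S} ↪ V := Function.Embedding.subtype _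
  have hcard : Fintype.card {v // v ∉ S} < n := by
    obtain ⟨s, hs⟩ := hS
    rw [← hn]
    exact Fintype.card_subtype_lt (x := s) (by simpa using hs)
  obtain ⟨ψ, hψ1, hψ2⟩ := ih _ hcard {v // v ∉ S} (G.comap f) (fun v => L v) rfl (by
      intro s hs
      have h := hsp (s.map f) (by simpa using hs)
      rw [card_map, sum_map] at h
      refine lt_of_eq_of_lt ?_ h
      congr 1
      refine sum_congr rfl fun v _ => ?_
      rw [filter_map, card_map]
      rfl) (by
      intro v
      refine le_trans ?_ (hdeg v)
      rw [← card_map f]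
      apply card_le_card
      intro x hx
      obtain ⟨y, hy, rfl⟩ := mem_map.1 hx
      exact mem_nb.2 (mem_nb (G := G.comap f).1 hy)) (fun v => hL v)
  refine ⟨fun v => if h : v ∉ S then ψ ⟨v, h⟩ else 0, ?_, ?_⟩
  · intro v hv
    simpa [hv] using hψ1 ⟨v, hv⟩
  · intro u v hu hv huv
    simp only [hu, hv, not_false_eq_true, dite_true]
    apply hψ2
    obtain ⟨h1, h2⟩ := huv
    refine ⟨by simpa using h1, ?_⟩
    rcases h2 with h2 | ⟨w, h2, h3⟩
    · exact Or.inl h2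
    · by_cases hw : w ∈ S
      · exact absurd (hone w hw u v hu hv h2.symm h3) h1
      · exact Or.inr ⟨⟨w, hw⟩, h2, h3⟩

lemma sparse_of_mad {V : Type} [Fintype V] (G : SimpleGraph V) (h : mad G < 8 / 3) :
    Sparse G := by
  intro s hs
  let H : G.Subgraph := (⊤ : G.Subgraph).induce (s : Set V)
  have hb : BddAbove {x : ℝ | ∃ H : G.Subgraph, H.verts.Nonempty ∧
      x = 2 * H.edgeSet.ncard / H.verts.ncard} := by
    apply Set.Finite.bddAbove
    refine (Set.finite_range
      (fun H : G.Subgraph => (2 * H.edgeSet.ncard / H.verts.ncard : ℝ))).subset ?_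
    rintro x ⟨H, -, rfl⟩
    exact ⟨H, rfl⟩
  have hle : (2 * H.edgeSet.ncard / H.verts.ncard : ℝ) ≤ mad G :=
    le_csSup hb ⟨H, by simpa [H] using hs, rfl⟩
  have hlt := lt_of_le_of_lt hle h
  have hv : H.verts.ncard = s.card := by simp [H]
  have hpos : (0 : ℝ) < s.card := by exact_mod_cast card_pos.2 hs
  rw [hv, div_lt_div_iff₀ hpos (by norm_num)] at hlt
  have hlt' : 2 * H.edgeSet.ncard * 3 < 8 * s.card := by exact_mod_cast hlt
  have hsum := H.spanningCoe.sum_degrees_eq_twice_card_edges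
  have he : H.spanningCoe.edgeFinset.card = H.edgeSet.ncard := by
    rw [← Set.ncard_coe_finset, SimpleGraph.coe_edgeFinset, SimpleGraph.Subgraph.edgeSet_spanningCoe]
  have hd : ∑ v, H.spanningCoe.degree v = ∑ v ∈ s, (s.filter (fun w => G.Adj v w)).card := by
    rw [← sum_subset (subset_univ s)]
    · refine sum_congr rfl fun v hv => ?_
      rw [← SimpleGraph.card_neighborFinset_eq_degree]
      congr 1
      ext x
      simp [H, hv]
    · intro v _ hv
      rw [← SimpleGraph.card_neighborFinset_eq_degree, card_eq_zero]
      ext x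
      simp [H, hv]
  rw [hd, he] at hsum
  omega

end TwoDist

/-- Main Theorem 1: every graph with `mad < 8/3` and `Δ ≥ 4` is 2-distance
`(Δ + 3)`-choosable. -/
theorem twoDist_choosable_of_mad_lt_eight_thirds
    {V : Type} [Fintype V] [DecidableEq V] (G : SimpleGraph V) [DecidableRel G.Adj]
    (hmad : mad G < 8 / 3) (hΔ : 4 ≤ G.maxDegree) :
    ∀ L : V → Finset ℕ, (∀ v, G.maxDegree + 3 ≤ (L v).card) →
      ∃ φ : V → ℕ, IsTwoDistListColoring G L φ := by
  intro L hL
  refine TwoDist.main G.maxDegree hΔ _ V G L rfl (TwoDist.sparse_of_mad G hmad) ?_ hL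
  intro v
  refine le_trans (le_of_eq ?_) (G.degree_le_maxDegree v)
  rw [← SimpleGraph.card_neighborFinset_eq_degree]
  congr 1
  ext x
  simp [TwoDist.nb]
end

section
/- If G is a planar graph with girth at least 8 and maximum degree Δ ≥ 4, then the 2-distance list chromatic number of G is at most Δ + 3. -/
open SimpleGraph

/-- A finite simple graph is planar iff it admits a straight-line plane embedding
(equivalent to topological planarity by Fáry's theorem). -/
def IsPlanar {V : Type} (G : SimpleGraph V) : Prop :=
  ∃ f : V → ℝ × ℝ, Function.Injective f ∧
    (∀ ⦃u v w⦄, G.Adj u v → f w ∈ segment ℝ (f u) (f v) → w = u ∨ w = v) ∧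
    (∀ ⦃u v x y⦄, G.Adj u v → G.Adj x y → s(u, v) ≠ s(x, y) →
      segment ℝ (f u) (f v) ∩ segment ℝ (f x) (f y) ⊆ f '' ({u, v} ∩ {x, y}))

/-- Every cycle has length at least eight. -/
def GirthEight {V : Type} (G : SimpleGraph V) : Prop :=
  ∀ (v : V) (c : G.Walk v v), c.IsCycle → 8 ≤ c.length

section SeqCycle

variable {V : Type} {G : SimpleGraph V}

/-- A walk following a sequence of vertices. -/
lemma exists_walk_of_seq (p : ℕ → V) (n : ℕ) (h : ∀ i < n, G.Adj (p i) (p (i + 1))) :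
    ∃ w : G.Walk (p 0) (p n), w.length = n ∧ w.support = (List.range (n + 1)).map p := by
  induction n with
  | zero => exact ⟨Walk.nil, by simp, by simp⟩
  | succ k ih =>
    obtain ⟨w, hw, hs⟩ := ih (fun i hi => h i (by omega))
    refine ⟨w.concat (h k (by omega)), by simp [hw], ?_⟩
    rw [Walk.support_concat, hs, List.range_succ (n := k + 1)]
    simp

lemma GirthEight.seq (hg : GirthEight G) (p : ℕ → V) (n : ℕ) (hn : 3 ≤ n)
    (h : ∀ i < n, G.Adj (p i) (p (i + 1))) (h0 : p n = p 0)
    (hinj : ∀ i < n, ∀ j < n, p i = p j → i = j) : 8 ≤ n := by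
  obtain ⟨m, rfl⟩ : ∃ m, n = m + 1 := ⟨n - 1, by omega⟩
  obtain ⟨w, hw, hs⟩ := exists_walk_of_seq p m (fun i hi => h i (by omega))
  have hpath : w.IsPath := by
    rw [Walk.isPath_def, hs]
    refine List.Nodup.map_on ?_ List.nodup_range
    intro x hx y hy hxy
    exact hinj x (by simpa using hx) y (by simpa using hy) hxy
  have hadj : G.Adj (p m) (p 0) := h0 ▸ h m (by omega)
  have hcyc : (Walk.cons hadj w).IsCycle := by
    rw [Walk.cons_isCycle_iff]
    refine ⟨hpath, ?_⟩
    intro hmem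
    have hm : m ≠ 1 := by omega
    -- the edge `p m - p 0` on a path from `p 0` to `p m` makes the path of length one
    have hl : w.length = 1 := hpath.length_eq_one_of_mem_edges (by rwa [Sym2.eq_swap])
    omega
  have := hg _ _ hcyc
  simpa [hw] using this

lemma GirthEight.no3 (hg : GirthEight G) {a b c : V} (h1 : G.Adj a b) (h2 : G.Adj b c)
    (h3 : G.Adj c a) : False := by
  have := hg a (Walk.cons h1 (Walk.cons h2 (Walk.cons h3 Walk.nil))) (by
    rw [Walk.isCycle_iff_isPath_tail_and_le_length]
    have := h1.ne; have := h2.ne; have := h3.ne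
    simp
    grind)
  simp at this

lemma GirthEight.no4 (hg : GirthEight G) {a b c d : V} (h1 : G.Adj a b) (h2 : G.Adj b c)
    (h3 : G.Adj c d) (h4 : G.Adj d a) (hac : a ≠ c) (hbd : b ≠ d) : False := by
  have := hg a (Walk.cons h1 (Walk.cons h2 (Walk.cons h3 (Walk.cons h4 Walk.nil)))) (by
    rw [Walk.isCycle_iff_isPath_tail_and_le_length]
    have := h1.ne; have := h2.ne; have := h3.ne; have := h4.ne
    simp
    grind)
  simp at this

lemma GirthEight.no5 (hg : GirthEight G) {a b c d e : V} (h1 : G.Adj a b) (h2 : G.Adj b c)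
    (h3 : G.Adj c d) (h4 : G.Adj d e) (h5 : G.Adj e a) : False := by
  have hac : a ≠ c := by rintro rfl; exact hg.no3 h3 h4 h5
  have had : a ≠ d := by rintro rfl; exact hg.no3 h1 h2 h3
  have hbd : b ≠ d := by rintro rfl; exact hg.no3 h4 h5 h1
  have hbe : b ≠ e := by rintro rfl; exact hg.no3 h2 h3 h4
  have hce : c ≠ e := by rintro rfl; exact hg.no3 h1 h2 h5
  have := hg a (Walk.cons h1 (Walk.cons h2 (Walk.cons h3 (Walk.cons h4
      (Walk.cons h5 Walk.nil))))) (by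
    rw [Walk.isCycle_iff_isPath_tail_and_le_length]
    have := h1.ne; have := h2.ne; have := h3.ne; have := h4.ne; have := h5.ne
    simp
    grind)
  simp at this

lemma GirthEight.no6 (hg : GirthEight G) {a b c d e f : V} (h1 : G.Adj a b) (h2 : G.Adj b c)
    (h3 : G.Adj c d) (h4 : G.Adj d e) (h5 : G.Adj e f) (h6 : G.Adj f a)
    (hac : a ≠ c) (hbd : b ≠ d) (hce : c ≠ e) : False := by
  have had : a ≠ d := by rintro rfl; exact hg.no3 h1 h2 h3
  have hbe : b ≠ e := by rintro rfl; exact hg.no3 h2 h3 h4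
  have hcf : c ≠ f := by rintro rfl; exact hg.no3 h3 h4 h5
  have hae : a ≠ e := by
    rintro rfl; exact hg.no4 h1 h2 h3 h4 hac hbd
  have hbf : b ≠ f := by
    rintro rfl; exact hg.no4 h2 h3 h4 h5 hbd hce
  by_cases hdf : d = f
  · subst hdf; exact hg.no4 h1 h2 h3 h6 hac hbd
  have := hg a (Walk.cons h1 (Walk.cons h2 (Walk.cons h3 (Walk.cons h4
      (Walk.cons h5 (Walk.cons h6 Walk.nil)))))) (by
    rw [Walk.isCycle_iff_isPath_tail_and_le_length]
    have := h1.ne; have := h2.ne; have := h3.ne; have := h4.ne; have := h5.ne; have := h6.ne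
    simp
    grind)
  simp at this

end SeqCycle

section Geometry

variable {V : Type}

/-- slope of the line through two points -/
noncomputable def slp (X Y : V → ℝ) (a b : V) : ℝ := (Y b - Y a) / (X b - X a)

/-- height at abscissa `x` of the line through two points -/
noncomputable def hgt (X Y : V → ℝ) (a b : V) (x : ℝ) : ℝ := Y a + slp X Y a b * (x - X a)

lemma slp_symm (X Y : V → ℝ) (a b : V) : slp X Y a b = slp X Y b a := by
  unfold slp
  rw [← neg_sub (Y a) (Y b), ← neg_sub (X a) (X b), neg_div_neg_eq]

lemma hgt_right (X Y : V → ℝ) {a b : V} (h : X a < X b) (x : ℝ) :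
    hgt X Y a b x = Y b + slp X Y a b * (x - X b) := by
  unfold hgt slp
  have : X b - X a ≠ 0 := by linarith
  field_simp
  ring

lemma hgt_at_left (X Y : V → ℝ) (a b : V) : hgt X Y a b (X a) = Y a := by
  simp [hgt]

lemma hgt_at_right (X Y : V → ℝ) {a b : V} (h : X a < X b) : hgt X Y a b (X b) = Y b := by
  rw [hgt_right X Y h]; simp

/-- Straight-line plane drawing in generic coordinates. -/
structure GenDrawing (G : SimpleGraph V) (X Y : V → ℝ) : Prop where
  inj : Function.Injective X
  meet : ∀ a b v u, G.Adj a b → G.Adj v u → X a < X b → X v < X u → ¬ (a = v ∧ b = u) →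
    ∀ x, X a ≤ x → x ≤ X b → X v ≤ x → x ≤ X u → hgt X Y a b x = hgt X Y v u x →
    ∃ w, (w = a ∨ w = b) ∧ (w = v ∨ w = u) ∧ X w = x

lemma exists_shear [Finite V] (f : V → ℝ × ℝ) (hf : Function.Injective f) :
    ∃ t : ℝ, Function.Injective (fun v => (f v).1 + t * (f v).2) := by
  classical
  let bad : V × V → ℝ := fun p => -((f p.1).1 - (f p.2).1) / ((f p.1).2 - (f p.2).2)
  obtain ⟨t, ht⟩ : ∃ t, t ∉ Set.range bad := (Set.finite_range bad).exists_notMem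
  refine ⟨t, fun u v huv => ?_⟩
  by_contra hne
  simp only at huv
  by_cases h2 : (f u).2 = (f v).2
  · apply hne
    apply hf
    ext
    · rw [h2] at huv; linarith
    · exact h2
  · apply ht
    refine ⟨(u, v), ?_⟩
    have : (f u).2 - (f v).2 ≠ 0 := sub_ne_zero.mpr h2
    simp only [bad]
    rw [div_eq_iff this]
    linarith

lemma exists_genDrawing [Finite V] {G : SimpleGraph V} (h : IsPlanar G) :
    ∃ X Y : V → ℝ, GenDrawing G X Y := by
  obtain ⟨f, hf, -, hX⟩ := h
  obtain ⟨t, ht⟩ := exists_shear f hf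
  refine ⟨fun v => (f v).1 + t * (f v).2, fun v => (f v).2, ht, ?_⟩
  intro a b v u hab hvu hXab hXvu hne x h1 h2 h3 h4 heq
  set X : V → ℝ := fun v => (f v).1 + t * (f v).2 with hXd
  set Y : V → ℝ := fun v => (f v).2 with hYd
  have key : ∀ c d, X c < X d → X c ≤ x → x ≤ X d →
      (x - t * hgt X Y c d x, hgt X Y c d x) ∈ segment ℝ (f c) (f d) := by
    intro c d hcd hc hd
    rw [segment_eq_image]
    have hpos : 0 < X d - X c := by linarith
    refine ⟨(x - X c) / (X d - X c), ⟨by apply div_nonneg <;> linarith, ?_⟩, ?_⟩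
    · rw [div_le_one hpos]; linarith
    · set s := (x - X c) / (X d - X c) with hs
      have hxs : x = X c + s * (X d - X c) := by rw [hs]; field_simp; ring
      have hh : hgt X Y c d x = Y c + s * (Y d - Y c) := by
        unfold hgt slp; rw [hs]; field_simp
      rw [hh]
      ext
      · simp only [Prod.fst_add, Prod.smul_fst, smul_eq_mul]
        rw [hxs]
        simp only [hXd, hYd]
        ring
      · simp only [Prod.snd_add, Prod.smul_snd, smul_eq_mul, hYd]
        ring
  have hs : s(a, b) ≠ s(v, u) := by
    intro hs
    rw [Sym2.eq_iff] at hs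
    rcases hs with hs | ⟨rfl, rfl⟩
    · exact hne hs
    · linarith
  have hmem := hX hab hvu hs ⟨key a b hXab h1 h2, heq ▸ key v u hXvu h3 h4⟩
  obtain ⟨w, ⟨hw1, hw2⟩, hw⟩ := hmem
  refine ⟨w, by simpa using hw1, by simpa using hw2, ?_⟩
  simp only [hXd, hw]
  ring

/-- Sign lemma for affine functions without zero in an open interval. -/
lemma affine_left {α β l r : ℝ} (hlr : l < r)
    (hz : ∀ x, l < x → x < r → α + β * x ≠ 0) :
    (α + β * l ≠ 0 → (0 < α + β * l ↔ 0 < α + β * ((l + r) / 2))) ∧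
    (α + β * l = 0 → (0 < β ↔ 0 < α + β * ((l + r) / 2))) := by
  constructor
  · intro h0
    have hm := hz ((l + r) / 2) (by linarith) (by linarith)
    by_contra hcon
    have hprod : (α + β * l) * (α + β * ((l + r) / 2)) < 0 := by
      rcases lt_or_gt_of_ne h0 with h | h <;> rcases lt_or_gt_of_ne hm with h' | h'
      · exact absurd (iff_of_false (by linarith) (by linarith)) hcon
      · exact mul_neg_of_neg_of_pos h h'
      · exact mul_neg_of_pos_of_neg h h'
      · exact absurd (iff_of_true h h') hcon
    have hβ : β ≠ 0 := by
      rintro rfl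
      simp only [zero_mul, add_zero] at hprod
      nlinarith [mul_self_nonneg α]
    have hx : α + β * (-α / β) = 0 := by field_simp; ring
    set q := -α / β with hq
    have hα : α = -β * q := by linarith
    have hprod' : β ^ 2 * ((l - q) * ((l + r) / 2 - q)) < 0 := by
      have : β ^ 2 * ((l - q) * ((l + r) / 2 - q))
          = (α + β * l) * (α + β * ((l + r) / 2)) := by rw [hα]; ring
      rw [this]; exact hprod
    refine hz q ?_ ?_ hx
    · by_contra hle
      have : 0 ≤ β ^ 2 * ((l - q) * ((l + r) / 2 - q)) :=
        mul_nonneg (sq_nonneg _) (mul_nonneg (by linarith) (by linarith))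
      linarith
    · by_contra hle
      have : 0 ≤ β ^ 2 * ((l - q) * ((l + r) / 2 - q)) :=
        mul_nonneg (sq_nonneg _) (mul_nonneg_of_nonpos_of_nonpos (by linarith) (by linarith))
      linarith
  · intro h0
    have : α + β * ((l + r) / 2) = β * ((r - l) / 2) := by linarith
    rw [this]
    have : 0 < (r - l) / 2 := by linarith
    constructor
    · intro h; positivity
    · intro h; exact (pos_iff_pos_of_mul_pos h).mpr this

lemma affine_right {α β l r : ℝ} (hlr : l < r)
    (hz : ∀ x, l < x → x < r → α + β * x ≠ 0) :
    (α + β * r ≠ 0 → (0 < α + β * r ↔ 0 < α + β * ((l + r) / 2))) ∧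
    (α + β * r = 0 → (β < 0 ↔ 0 < α + β * ((l + r) / 2))) := by
  have := affine_left (α := α) (β := -β) (l := -r) (r := -l) (by linarith)
    (fun x h1 h2 => by
      have := hz (-x) (by linarith) (by linarith)
      intro h; apply this; linarith)
  have e : (-r + -l) / 2 = -((l + r) / 2) := by ring
  rw [e] at this
  simpa using this

/-- `p` lies strictly above the open segment `v u`. -/
def InReg (X Y : V → ℝ) (v u p : V) : Prop :=
  X v < X p ∧ X p < X u ∧ hgt X Y v u (X p) < Y p

/-- the edge `a b` passes strictly above `v`. -/
def Over (X Y : V → ℝ) (v a b : V) : Prop :=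
  X a < X v ∧ X v < X b ∧ Y v < hgt X Y a b (X v)

lemma GenDrawing.above_iff {G : SimpleGraph V} {X Y : V → ℝ} (D : GenDrawing G X Y)
    {a b v u : V} (hab : G.Adj a b) (hvu : G.Adj v u) (hXab : X a < X b) (hXvu : X v < X u)
    (hne : ¬ (a = v ∧ b = u)) :
    (Over X Y v a b ∨ (a = v ∧ slp X Y v u < slp X Y v b) ∨ InReg X Y v u a) ↔
    (Over X Y u a b ∨ (b = u ∧ slp X Y u a < slp X Y u v) ∨ InReg X Y v u b) := by
  by_cases hov : X b ≤ X v ∨ X u ≤ X a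
  · refine iff_of_false ?_ ?_
    · rintro (⟨h1, h2, -⟩ | ⟨rfl, -⟩ | ⟨h1, h2, -⟩) <;> rcases hov with h | h <;> linarith
    · rintro (⟨h1, h2, -⟩ | ⟨rfl, -⟩ | ⟨h1, h2, -⟩) <;> rcases hov with h | h <;> linarith
  push Not at hov
  obtain ⟨ho1, ho2⟩ := hov
  set l := max (X a) (X v) with hl
  set r := min (X b) (X u) with hr
  have hlr : l < r := by
    rw [hl, hr, max_lt_iff, lt_min_iff, lt_min_iff]; exact ⟨⟨hXab, ho2⟩, ho1, hXvu⟩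
  have hla : X a ≤ l := le_max_left _ _
  have hlv : X v ≤ l := le_max_right _ _
  have hrb : r ≤ X b := min_le_left _ _
  have hru : r ≤ X u := min_le_right _ _
  set β := slp X Y a b - slp X Y v u with hβ
  set α := (Y a - slp X Y a b * X a) - (Y v - slp X Y v u * X v) with hα
  have hg : ∀ x, α + β * x = hgt X Y a b x - hgt X Y v u x := by
    intro x; simp only [hα, hβ, hgt]; ring
  have hmeet : ∀ x, l ≤ x → x ≤ r → α + β * x = 0 →
      ∃ w, (w = a ∨ w = b) ∧ (w = v ∨ w = u) ∧ X w = x := by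
    intro x h1 h2 h0
    rw [hg] at h0
    exact D.meet a b v u hab hvu hXab hXvu hne x (by linarith) (by linarith) (by linarith)
      (by linarith) (by linarith)
  have hz : ∀ x, l < x → x < r → α + β * x ≠ 0 := by
    intro x h1 h2 h0
    obtain ⟨w, hw1, hw2, hw⟩ := hmeet x h1.le h2.le h0
    rcases hw1 with rfl | rfl <;> linarith
  obtain ⟨L1, L2⟩ := affine_left hlr hz
  obtain ⟨R1, R2⟩ := affine_right hlr hz
  trans 0 < α + β * ((l + r) / 2)
  · rcases lt_trichotomy (X a) (X v) with h | h | h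
    · have e : l = X v := max_eq_right h.le
      have h0 : α + β * l ≠ 0 := by
        intro h0
        obtain ⟨w, hw1, hw2, hw⟩ := hmeet l le_rfl hlr.le h0
        rcases hw1 with rfl | rfl <;> linarith
      rw [← L1 h0, hg, e, hgt_at_left]
      constructor
      · rintro (⟨h1, h2, h3⟩ | ⟨rfl, -⟩ | ⟨h1, h2, -⟩) <;> linarith
      · intro h'; exact Or.inl ⟨h, ho1, by linarith⟩
    · have hav : a = v := D.inj h
      subst hav
      have e : l = X a := max_eq_right h.le
      have h0 : α + β * l = 0 := by
        rw [hg, e, hgt_at_left, hgt_at_left]; ring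
      rw [← L2 h0, hβ]
      constructor
      · rintro (⟨h1, h2, h3⟩ | ⟨-, h1⟩ | ⟨h1, h2, -⟩) <;> linarith
      · intro h'; exact Or.inr (Or.inl ⟨rfl, by linarith⟩)
    · have e : l = X a := max_eq_left h.le
      have h0 : α + β * l ≠ 0 := by
        intro h0
        obtain ⟨w, hw1, hw2, hw⟩ := hmeet l le_rfl hlr.le h0
        rcases hw2 with rfl | rfl <;> linarith
      rw [← L1 h0, hg, e, hgt_at_left]
      constructor
      · rintro (⟨h1, h2, h3⟩ | ⟨rfl, -⟩ | ⟨h1, h2, h3⟩) <;> linarith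
      · intro h'; exact Or.inr (Or.inr ⟨h, ho2, by linarith⟩)
  · symm
    rcases lt_trichotomy (X u) (X b) with h | h | h
    · have e : r = X u := min_eq_right h.le
      have h0 : α + β * r ≠ 0 := by
        intro h0
        obtain ⟨w, hw1, hw2, hw⟩ := hmeet r hlr.le le_rfl h0
        rcases hw1 with rfl | rfl <;> linarith
      rw [← R1 h0, hg, e, hgt_at_right X Y hXvu]
      constructor
      · rintro (⟨h1, h2, h3⟩ | ⟨rfl, -⟩ | ⟨h1, h2, -⟩) <;> linarith
      · intro h'; exact Or.inl ⟨ho2, h, by linarith⟩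
    · have hbu : u = b := D.inj h
      subst hbu
      have e : r = X u := min_eq_right h.le
      have h0 : α + β * r = 0 := by
        rw [hg, e, hgt_at_right X Y hXvu, hgt_at_right X Y hXab]; ring
      rw [← R2 h0, hβ, slp_symm X Y u a, slp_symm X Y u v]
      constructor
      · rintro (⟨h1, h2, h3⟩ | ⟨-, h1⟩ | ⟨h1, h2, -⟩) <;> linarith
      · intro h'; exact Or.inr (Or.inl ⟨rfl, by linarith⟩)
    · have e : r = X b := min_eq_left h.le
      have h0 : α + β * r ≠ 0 := by
        intro h0
        obtain ⟨w, hw1, hw2, hw⟩ := hmeet r hlr.le le_rfl h0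
        rcases hw2 with rfl | rfl <;> linarith
      rw [← R1 h0, hg, e, hgt_at_right X Y hXab]
      constructor
      · rintro (⟨h1, h2, h3⟩ | ⟨rfl, -⟩ | ⟨h1, h2, h3⟩) <;> linarith
      · intro h'; exact Or.inr (Or.inr ⟨ho1, h, by linarith⟩)

/-- Two edges on the same side of a vertex have different slopes. -/
lemma GenDrawing.slope_ne {G : SimpleGraph V} {X Y : V → ℝ} (D : GenDrawing G X Y)
    {v u w : V} (hu : G.Adj v u) (hw : G.Adj v w) (hside : X v < X u ↔ X v < X w)
    (hs : slp X Y v u = slp X Y v w) : u = w := by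
  by_contra hne
  rcases lt_trichotomy (X v) (X u) with h | h | h
  · have h' := hside.mp h
    obtain ⟨y, h1, h2, h3⟩ := D.meet v u v w hu hw h h' (by tauto) (min (X u) (X w))
      (by rw [le_min_iff]; constructor <;> linarith) (min_le_left _ _)
      (by rw [le_min_iff]; constructor <;> linarith) (min_le_right _ _)
      (by simp only [hgt, hs])
    have h4 : X v < min (X u) (X w) := lt_min h h'
    have hyv : y ≠ v := by rintro rfl; linarith
    rcases h1 with rfl | rfl
    · exact hyv rfl
    · rcases h2 with h2 | h2
      · exact hyv h2
      · exact hne h2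
  · exact hu.ne (D.inj h)
  · have h' : X w < X v := by
      refine lt_of_le_of_ne (not_lt.mp fun hh => ?_) (fun hh => hw.ne (D.inj hh.symm))
      have := hside.mpr hh; linarith
    obtain ⟨y, h1, h2, h3⟩ := D.meet u v w v hu.symm hw.symm h h' (by tauto) (max (X u) (X w))
      (le_max_left _ _) (by rw [max_le_iff]; constructor <;> linarith)
      (le_max_right _ _) (by rw [max_le_iff]; constructor <;> linarith)
      (by rw [hgt_right X Y h, hgt_right X Y h', slp_symm X Y u v, slp_symm X Y w v, hs])
    have h4 : max (X u) (X w) < X v := max_lt h h'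
    have hyv : y ≠ v := by rintro rfl; linarith
    rcases h1 with rfl | rfl
    · rcases h2 with h2 | h2
      · exact hne h2
      · exact hyv h2
    · exact hyv rfl

end Geometry

section Parity

open Classical in
/-- indicator with values in `ZMod 2` -/
noncomputable def ind (P : Prop) : ZMod 2 := if P then 1 else 0

lemma ind_true {P : Prop} (h : P) : ind P = 1 := by simp [ind, h]
lemma ind_false {P : Prop} (h : ¬ P) : ind P = 0 := by simp [ind, h]
lemma ind_congr {P Q : Prop} (h : P ↔ Q) : ind P = ind Q := by rw [propext h]

lemma ind_or {P Q : Prop} (h : ¬ (P ∧ Q)) : ind (P ∨ Q) = ind P + ind Q := by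
  by_cases hP : P
  · have hQ : ¬ Q := fun hQ => h ⟨hP, hQ⟩
    simp [ind, hP, hQ]
  · by_cases hQ : Q <;> simp [ind, hP, hQ]

lemma ind_add_not (P : Prop) : ind P + ind (¬ P) = 1 := by
  by_cases hP : P <;> simp [ind, hP]

lemma zmod2_add_self (x : ZMod 2) : x + x = 0 := CharTwo.add_self_eq_zero x

variable {V : Type}

/-- Clockwise sorting key of the neighbours of `v`, starting from the upward direction. -/
noncomputable def ckey (X Y : V → ℝ) (v w : V) : ℕ ×ₗ ℝ :=
  toLex ((open Classical in if X v < X w then 0 else 1), - slp X Y v w)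

lemma ckey_lt_right {X Y : V → ℝ} {v u w : V} (h : X v < X u) :
    ckey X Y v w < ckey X Y v u ↔ X v < X w ∧ slp X Y v u < slp X Y v w := by
  unfold ckey
  rw [Prod.Lex.toLex_lt_toLex]
  by_cases hw : X v < X w <;> simp [h, hw]

lemma ckey_lt_left {X Y : V → ℝ} {v u w : V} (h : ¬ X v < X u) :
    ckey X Y v w < ckey X Y v u ↔ X v < X w ∨ slp X Y v u < slp X Y v w := by
  unfold ckey
  rw [Prod.Lex.toLex_lt_toLex]
  by_cases hw : X v < X w <;> simp [h, hw]

variable [Fintype V]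

/-- Side value of the dart `v → u`. -/
noncomputable def side (X Y : V → ℝ) (z : V → V → ZMod 2) (v u : V) : ZMod 2 :=
  (∑ a, ∑ b, ind (Over X Y v a b) * z a b) + ∑ w, ind (ckey X Y v w < ckey X Y v u) * z v w

lemma side_symm_aux {G : SimpleGraph V} {X Y : V → ℝ} (D : GenDrawing G X Y)
    {z : V → V → ZMod 2} (hsym : ∀ a b, z a b = z b a) (hadj : ∀ a b, ¬ G.Adj a b → z a b = 0)
    (heven : ∀ a, ∑ b, z a b = 0) {v u : V} (hvu : G.Adj v u) (hX : X v < X u) :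
    side X Y z v u + side X Y z u v = z v u := by
  have e2 : ∑ w, ind (ckey X Y v w < ckey X Y v u) * z v w
      = ∑ a, ∑ b, ind (a = v ∧ X a < X b ∧ slp X Y v u < slp X Y v b) * z a b := by
    symm
    rw [Finset.sum_eq_single v]
    · refine Finset.sum_congr rfl fun w _ => ?_
      rw [ind_congr (ckey_lt_right hX)]
      congr 1
      exact ind_congr (by simp)
    · intro a _ hav
      refine Finset.sum_eq_zero fun b _ => ?_
      rw [ind_false (by tauto), zero_mul]
    · simp
  have e4 : ∑ w, ind (ckey X Y u w < ckey X Y u v) * z u w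
      = z v u + ∑ a, ∑ b, ind (b = u ∧ X a < X b ∧ slp X Y u a < slp X Y u v) * z a b := by
    have s1 : ∑ w, ind (ckey X Y u w < ckey X Y u v) * z u w
        = ∑ w, ind (¬ ckey X Y u w < ckey X Y u v) * z u w := by
      have : ∑ w, ind (ckey X Y u w < ckey X Y u v) * z u w
        + ∑ w, ind (¬ ckey X Y u w < ckey X Y u v) * z u w = 0 := by
        rw [← Finset.sum_add_distrib, ← heven u]
        refine Finset.sum_congr rfl fun w _ => ?_
        rw [← add_mul, ind_add_not, one_mul]
      exact CharTwo.add_eq_zero.mp this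
    have s2 : ∑ a, ∑ b, ind (b = u ∧ X a < X b ∧ slp X Y u a < slp X Y u v) * z a b
        = ∑ w, ind (X w < X u ∧ slp X Y u w < slp X Y u v) * z u w := by
      rw [Finset.sum_comm, Finset.sum_eq_single u]
      · refine Finset.sum_congr rfl fun w _ => ?_
        rw [hsym w u]
        congr 1
        exact ind_congr (by simp)
      · intro a _ hav
        refine Finset.sum_eq_zero fun b _ => ?_
        rw [ind_false (by tauto), zero_mul]
      · simp
    have s3 : z v u = ∑ w, ind (w = v) * z u w := by
      rw [Finset.sum_eq_single v]
      · rw [ind_true rfl, one_mul, hsym]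
      · intro b _ hb; rw [ind_false hb, zero_mul]
      · simp
    rw [s1, s2, s3, ← Finset.sum_add_distrib]
    refine Finset.sum_congr rfl fun w _ => ?_
    by_cases hw : G.Adj u w
    swap
    · simp [hadj u w hw]
    rw [← add_mul, ← ind_or]
    · congr 1
      apply ind_congr
      rw [ckey_lt_left (by linarith)]
      push Not
      constructor
      · rintro ⟨h1, h2⟩
        have h1' : X w < X u := lt_of_le_of_ne h1 (fun hh => hw.ne (D.inj hh.symm))
        rcases lt_or_eq_of_le h2 with h | h
        · exact Or.inr ⟨h1', h⟩
        · left
          exact D.slope_ne hw hvu.symm (iff_of_false (by linarith) (by linarith)) h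
      · rintro (rfl | ⟨h1, h2⟩)
        · exact ⟨hX.le, le_rfl⟩
        · exact ⟨h1.le, h2.le⟩
    · rintro ⟨rfl, -, h⟩
      exact lt_irrefl _ h
  have e5 : ∑ a, ∑ b, (ind (X a < X b ∧ InReg X Y v u a) + ind (X a < X b ∧ InReg X Y v u b))
      * z a b = 0 := by
    have s1 : ∑ a, ∑ b, ind (InReg X Y v u a) * z a b = 0 := by
      refine Finset.sum_eq_zero fun a _ => ?_
      rw [← Finset.mul_sum, heven, mul_zero]
    have s2 : ∑ a, ∑ b, ind (InReg X Y v u a) * z a b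
        = ∑ a, ∑ b, ind (X a < X b ∧ InReg X Y v u a) * z a b
          + ∑ a, ∑ b, ind (X b < X a ∧ InReg X Y v u a) * z a b := by
      rw [← Finset.sum_add_distrib]
      refine Finset.sum_congr rfl fun a _ => ?_
      rw [← Finset.sum_add_distrib]
      refine Finset.sum_congr rfl fun b _ => ?_
      by_cases hab : G.Adj a b
      swap
      · simp [hadj a b hab]
      rw [← add_mul, ← ind_or]
      · congr 1
        apply ind_congr
        have : X a < X b ∨ X b < X a := lt_or_gt_of_ne fun h => hab.ne (D.inj h)
        tauto
      · rintro ⟨⟨h1, -⟩, h2, -⟩; linarith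
    have s3 : ∑ a, ∑ b, ind (X b < X a ∧ InReg X Y v u a) * z a b
        = ∑ a, ∑ b, ind (X a < X b ∧ InReg X Y v u b) * z a b := by
      rw [Finset.sum_comm]
      refine Finset.sum_congr rfl fun a _ => Finset.sum_congr rfl fun b _ => ?_
      rw [hsym b a]
    rw [s1, s3] at s2
    rw [s2, ← Finset.sum_add_distrib]
    refine Finset.sum_congr rfl fun a _ => ?_
    rw [← Finset.sum_add_distrib]
    refine Finset.sum_congr rfl fun b _ => ?_
    rw [add_mul]
  have e6 : (∑ a, ∑ b, ind (Over X Y v a b) * z a b)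
      + (∑ a, ∑ b, ind (a = v ∧ X a < X b ∧ slp X Y v u < slp X Y v b) * z a b)
      + (∑ a, ∑ b, ind (Over X Y u a b) * z a b)
      + (∑ a, ∑ b, ind (b = u ∧ X a < X b ∧ slp X Y u a < slp X Y u v) * z a b)
      + (∑ a, ∑ b, (ind (X a < X b ∧ InReg X Y v u a) + ind (X a < X b ∧ InReg X Y v u b))
      * z a b) = 0 := by
    simp only [← Finset.sum_add_distrib]
    refine Finset.sum_eq_zero fun a _ => Finset.sum_eq_zero fun b _ => ?_
    by_cases hab : G.Adj a b
    swap
    · simp [hadj a b hab]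
    simp only [← add_mul]
    convert zero_mul (z a b) using 2
    by_cases hXab : X a < X b
    swap
    · have h1 : ∀ p, ¬ Over X Y p a b := by
        rintro p ⟨h1, h2, -⟩; linarith
      rw [ind_false (h1 _), ind_false (h1 _), ind_false (by tauto), ind_false (by tauto),
        ind_false (by tauto), ind_false (by tauto)]
      simp
    by_cases hne : a = v ∧ b = u
    · obtain ⟨rfl, rfl⟩ := hne
      rw [ind_false, ind_false, ind_false, ind_false, ind_false, ind_false]
      · simp
      · rintro ⟨-, -, h, -⟩; exact lt_irrefl _ h
      · rintro ⟨-, h, -⟩; exact lt_irrefl _ h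
      · rintro ⟨-, -, h⟩; exact lt_irrefl _ h
      · rintro ⟨-, h, -⟩; exact lt_irrefl _ h
      · rintro ⟨-, -, h⟩; exact lt_irrefl _ h
      · rintro ⟨h, -⟩; exact lt_irrefl _ h
    have main := ind_congr (D.above_iff hab hvu hXab hX hne)
    rw [ind_or, ind_or, ind_or, ind_or] at main
    · simp only [hXab, true_and]
      have := zmod2_add_self (ind (Over X Y u a b) + (ind (b = u ∧ slp X Y u a < slp X Y u v)
        + ind (InReg X Y v u b)))
      rw [← this]
      nth_rewrite 1 [← main]
      ring
    · rintro ⟨⟨rfl, -⟩, -, h, -⟩; exact lt_irrefl _ h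
    · rintro ⟨⟨-, h, -⟩, ⟨rfl, -⟩ | ⟨-, h', -⟩⟩ <;> linarith
    · rintro ⟨⟨rfl, -⟩, h, -⟩; exact lt_irrefl _ h
    · rintro ⟨⟨h, -⟩, ⟨rfl, -⟩ | ⟨h', -⟩⟩ <;> linarith
  rw [e5, add_zero] at e6
  unfold side
  rw [e2, e4]
  calc _ = ((∑ a, ∑ b, ind (Over X Y v a b) * z a b)
      + (∑ a, ∑ b, ind (a = v ∧ X a < X b ∧ slp X Y v u < slp X Y v b) * z a b)
      + (∑ a, ∑ b, ind (Over X Y u a b) * z a b)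
      + (∑ a, ∑ b, ind (b = u ∧ X a < X b ∧ slp X Y u a < slp X Y u v) * z a b)) + z v u := by
        ring
    _ = _ := by rw [e6, zero_add]

lemma side_symm {G : SimpleGraph V} {X Y : V → ℝ} (D : GenDrawing G X Y)
    {z : V → V → ZMod 2} (hsym : ∀ a b, z a b = z b a) (hadj : ∀ a b, ¬ G.Adj a b → z a b = 0)
    (heven : ∀ a, ∑ b, z a b = 0) {v u : V} (hvu : G.Adj v u) :
    side X Y z v u + side X Y z u v = z v u := by
  rcases lt_or_gt_of_ne (fun h => hvu.ne (D.inj h)) with h | h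
  · exact side_symm_aux D hsym hadj heven hvu h
  · rw [add_comm, hsym]
    exact side_symm_aux D hsym hadj heven hvu.symm h

lemma ckey_inj {V : Type} {G : SimpleGraph V} {X Y : V → ℝ} (D : GenDrawing G X Y) {v u w : V}
    (hu : G.Adj v u) (hw : G.Adj v w) (h : ckey X Y v u = ckey X Y v w) : u = w := by
  unfold ckey at h
  rw [toLex_inj, Prod.mk.injEq] at h
  obtain ⟨h1, h2⟩ := h
  refine D.slope_ne hu hw ?_ (by linarith)
  by_cases a : X v < X u <;> by_cases b : X v < X w <;>
    first | exact iff_of_true a b | exact iff_of_false a b | simp [a, b] at h1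

/-- the next dart along the face on the left -/
lemma exists_next {G : SimpleGraph V} {X Y : V → ℝ} (D : GenDrawing G X Y)
    {v u : V} (hvu : G.Adj v u) (hdeg : ∃ w, w ≠ u ∧ G.Adj v w) :
    ∃ w, w ≠ u ∧ G.Adj v w ∧ ∀ z : V → V → ZMod 2, (∀ a b, z a b = z b a) →
      (∀ a b, ¬ G.Adj a b → z a b = 0) → (∀ a, ∑ b, z a b = 0) →
      side X Y z u v = side X Y z v w := by
  classical
  -- it suffices to compare the keys
  have red : ∀ w, w ≠ u → G.Adj v w → (∀ z : V → V → ZMod 2,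
      (∀ a b, ¬ G.Adj a b → z a b = 0) → (∀ a, ∑ b, z a b = 0) →
      ∑ y, ind (ckey X Y v y < ckey X Y v w) * z v y
        = ∑ y, ind (ckey X Y v y < ckey X Y v u) * z v y + z v u) →
      ∃ w, w ≠ u ∧ G.Adj v w ∧ ∀ z : V → V → ZMod 2, (∀ a b, z a b = z b a) →
      (∀ a b, ¬ G.Adj a b → z a b = 0) → (∀ a, ∑ b, z a b = 0) →
      side X Y z u v = side X Y z v w := by
    intro w hwu hw h
    refine ⟨w, hwu, hw, fun z hsym hadj heven => ?_⟩
    have h1 := side_symm D hsym hadj heven hvu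
    have h2 : side X Y z v w = side X Y z v u + z v u := by
      unfold side
      rw [h z hadj heven]; ring
    rw [h2, ← h1, ← add_assoc, zmod2_add_self, zero_add]
  have hsum : ∀ z : V → V → ZMod 2, z v u = ∑ y, ind (y = u) * z v y := by
    intro z
    rw [Finset.sum_eq_single u]
    · rw [ind_true rfl, one_mul]
    · intro b _ hb; rw [ind_false hb, zero_mul]
    · simp
  let A : Finset V := Finset.univ.filter fun w => G.Adj v w ∧ ckey X Y v u < ckey X Y v w
  by_cases hA : A.Nonempty
  · obtain ⟨w, hwA, hmin⟩ := Finset.exists_min_image A (ckey X Y v) hA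
    simp only [A, Finset.mem_filter, Finset.mem_univ, true_and] at hwA hmin
    refine red w ?_ hwA.1 ?_
    · rintro rfl; exact lt_irrefl _ hwA.2
    intro z hadj heven
    rw [hsum z, ← Finset.sum_add_distrib]
    refine Finset.sum_congr rfl fun y _ => ?_
    by_cases hy : G.Adj v y
    swap
    · simp [hadj v y hy]
    rw [← add_mul, ← ind_or]
    · congr 1
      apply ind_congr
      constructor
      · intro h
        rcases lt_trichotomy (ckey X Y v y) (ckey X Y v u) with h' | h' | h'
        · exact Or.inl h'
        · exact Or.inr (ckey_inj D hy hvu h')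
        · exact absurd (hmin y ⟨hy, h'⟩) (not_le.mpr h)
      · rintro (h | rfl)
        · exact h.trans hwA.2
        · exact hwA.2
    · rintro ⟨h, rfl⟩; exact lt_irrefl _ h
  · have hmax : ∀ y, G.Adj v y → ckey X Y v y ≤ ckey X Y v u := by
      intro y hy
      by_contra hcon
      exact hA ⟨y, by simp [A, hy, not_le.mp hcon]⟩
    let B : Finset V := Finset.univ.filter fun w => G.Adj v w
    obtain ⟨w, hwB, hmin⟩ := Finset.exists_min_image B (ckey X Y v) ⟨u, by simp [B, hvu]⟩
    simp only [B, Finset.mem_filter, Finset.mem_univ, true_and] at hwB hmin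
    refine red w ?_ hwB ?_
    · rintro rfl
      obtain ⟨y, hyu, hy⟩ := hdeg
      exact hyu (ckey_inj D hy hvu (le_antisymm (hmax y hy) (hmin y hy)))
    intro z hadj heven
    rw [hsum z, ← Finset.sum_add_distrib]
    trans 0
    · refine Finset.sum_eq_zero fun y _ => ?_
      by_cases hy : G.Adj v y
      · rw [ind_false (not_lt.mpr (hmin y hy)), zero_mul]
      · simp [hadj v y hy]
    · rw [← heven v]
      refine Finset.sum_congr rfl fun y _ => ?_
      by_cases hy : G.Adj v y
      swap
      · simp [hadj v y hy]
      rw [← add_mul, ← ind_or, ind_true, one_mul]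
      · rcases lt_or_eq_of_le (hmax y hy) with h | h
        · exact Or.inl h
        · exact Or.inr (ckey_inj D hy hvu h)
      · rintro ⟨h, rfl⟩; exact lt_irrefl _ h

end Parity

section Euler

variable {V : Type} {G : SimpleGraph V}

open Classical in
/-- extend a function on edges to pairs of vertices -/
noncomputable def zext (G : SimpleGraph V) (m : G.edgeSet → ZMod 2) (a b : V) : ZMod 2 :=
  if h : G.Adj a b then m ⟨s(a, b), h⟩ else 0

lemma zext_symm (m : G.edgeSet → ZMod 2) (a b : V) : zext G m a b = zext G m b a := by
  unfold zext
  by_cases h : G.Adj a b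
  · rw [dif_pos h, dif_pos h.symm]
    congr 2
    exact Sym2.eq_swap
  · rw [dif_neg h, dif_neg (fun h' => h h'.symm)]

lemma zext_nonadj (m : G.edgeSet → ZMod 2) (a b : V) (h : ¬ G.Adj a b) : zext G m a b = 0 := by
  simp [zext, h]

lemma zext_add (m m' : G.edgeSet → ZMod 2) (a b : V) :
    zext G (m + m') a b = zext G m a b + zext G m' a b := by
  unfold zext
  split_ifs <;> simp

lemma zext_smul (c : ZMod 2) (m : G.edgeSet → ZMod 2) (a b : V) :
    zext G (c • m) a b = c * zext G m a b := by
  unfold zext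
  split_ifs <;> simp

variable [Fintype V]

/-- boundary map -/
noncomputable def bdry (G : SimpleGraph V) :
    (G.edgeSet → ZMod 2) →ₗ[ZMod 2] (V → ZMod 2) where
  toFun m a := ∑ b, zext G m a b
  map_add' m m' := by
    funext a
    simp [zext_add, Finset.sum_add_distrib]
  map_smul' c m := by
    funext a
    simp [zext_smul, Finset.mul_sum]

/-- side functional -/
noncomputable def sideL (G : SimpleGraph V) (X Y : V → ℝ) (v u : V) :
    (G.edgeSet → ZMod 2) →ₗ[ZMod 2] ZMod 2 where
  toFun m := side X Y (zext G m) v u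
  map_add' m m' := by
    simp only [side, zext_add, mul_add, Finset.sum_add_distrib]
    ring
  map_smul' c m := by
    simp only [side, zext_smul, smul_eq_mul, RingHom.id_apply, mul_add, Finset.mul_sum]
    congr 1
    · exact Finset.sum_congr rfl fun a _ => Finset.sum_congr rfl fun b _ => by ring
    · exact Finset.sum_congr rfl fun a _ => by ring

lemma sum_bdry (m : G.edgeSet → ZMod 2) : ∑ a, bdry G m a = 0 := by
  change ∑ a, ∑ b, zext G m a b = 0
  rw [← Finset.sum_product']
  refine Finset.sum_involution (fun p _ => (p.2, p.1)) ?_ ?_ ?_ ?_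
  · intro p _
    simp only
    rw [zext_symm m p.2 p.1, zmod2_add_self]
  · intro p _ hp heq
    apply hp
    have : p.1 = p.2 := by
      have := congrArg Prod.fst heq
      exact this.symm
    rw [this]
    exact zext_nonadj m _ _ (G.loopless.irrefl _)
  · simp
  · simp

lemma finrank_range_bdry_lt [Nonempty V] :
    Module.finrank (ZMod 2) (LinearMap.range (bdry G)) < Fintype.card V := by
  classical
  have hne : LinearMap.range (bdry G) ≠ ⊤ := by
    intro h
    obtain ⟨r⟩ := ‹Nonempty V›
    have : (Pi.single r 1 : V → ZMod 2) ∈ LinearMap.range (bdry G) := h ▸ Submodule.mem_top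
    obtain ⟨m, hm⟩ := this
    have h0 := sum_bdry m
    rw [hm] at h0
    simp at h0
  have := Submodule.finrank_lt hne
  simpa using this

/-- the darts of one face class -/
lemma fiber_ge_eight (hg : GirthEight G) [Fintype G.Dart] {α : Type} [DecidableEq α]
    (τ : G.Dart → α)
    (hnext : ∀ d : G.Dart, ∃ d' : G.Dart, d'.fst = d.snd ∧ d'.snd ≠ d.fst ∧ τ d' = τ d)
    (d : G.Dart) : 8 ≤ (Finset.univ.filter fun d' => τ d' = τ d).card := by
  choose nx h1 h2 h3 using hnext
  let sq : ℕ → G.Dart := fun i => nx^[i] d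
  have hsq : ∀ i, sq (i + 1) = nx (sq i) := fun i => Function.iterate_succ_apply' nx i d
  have hτ : ∀ i, τ (sq i) = τ d := by
    intro i
    induction i with
    | zero => rfl
    | succ k ih => rw [hsq, h3, ih]
  let p : ℕ → V := fun i => (sq i).fst
  have hp1 : ∀ i, p (i + 1) = (sq i).snd := by
    intro i; simp only [p]; rw [hsq, h1]
  have hadj : ∀ i, G.Adj (p i) (p (i + 1)) := by
    intro i; rw [hp1]; exact (sq i).adj
  have hp2 : ∀ i, p (i + 2) ≠ p i := by
    intro i; rw [hp1, hsq]; exact h2 _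
  have hex : ∃ n, 0 < n ∧ ∃ i, p i = p (i + n) := by
    obtain ⟨i, j, hij, h⟩ := Finite.exists_ne_map_eq_of_infinite p
    rcases lt_or_gt_of_ne hij with hlt | hlt
    · exact ⟨j - i, by omega, i, by rw [h]; congr 1; omega⟩
    · exact ⟨i - j, by omega, j, by rw [← h]; congr 1; omega⟩
  classical
  obtain ⟨hn0, i, hi⟩ := Nat.find_spec hex
  have hmin := fun m (hm : m < Nat.find hex) => Nat.find_min hex hm
  set n := Nat.find hex
  have hinj : ∀ a < n, ∀ b < n, p (i + a) = p (i + b) → a = b := by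
    intro a ha b hb hab
    rcases lt_trichotomy a b with h | h | h
    · exact absurd ⟨by omega, i + a, by rw [hab]; congr 1; omega⟩ (hmin (b - a) (by omega))
    · exact h
    · exact absurd ⟨by omega, i + b, by rw [← hab]; congr 1; omega⟩ (hmin (a - b) (by omega))
  have hn3 : 3 ≤ n := by
    by_contra hlt
    have : n = 1 ∨ n = 2 := by omega
    rcases this with h | h
    · rw [h] at hi; exact (hadj i).ne hi
    · rw [h] at hi; exact hp2 i hi.symm
  have h8 : 8 ≤ n := hg.seq (fun k => p (i + k)) n hn3 (fun k _ => hadj (i + k)) hi.symm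
    (fun a ha b hb h => hinj a ha b hb h)
  calc 8 ≤ n := h8
    _ = (Finset.range n).card := by simp
    _ ≤ _ := by
      refine Finset.card_le_card_of_injOn (fun k => sq (i + k)) ?_ ?_
      · intro k _; simp [hτ]
      · intro a ha b hb hab
        exact hinj a (by simpa using ha) b (by simpa using hb) (congrArg (fun e => e.fst) hab)

theorem sparse_of_planar [DecidableEq V] [DecidableRel G.Adj] [Nonempty V]
    (hpl : IsPlanar G) (hg : GirthEight G)
    (hdeg : ∀ v, 2 ≤ G.degree v) : 3 * G.edgeFinset.card < 4 * Fintype.card V := by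
  classical
  obtain ⟨X, Y, D⟩ := exists_genDrawing hpl
  let Z := LinearMap.ker (bdry G)
  have hZ : ∀ m : Z, ∀ a, ∑ b, zext G m.1 a b = 0 := by
    intro m a
    exact congrFun (LinearMap.mem_ker.mp m.2) a
  let τ : G.Dart → (Z →ₗ[ZMod 2] ZMod 2) := fun d => (sideL G X Y d.fst d.snd).comp Z.subtype
  have hτ : ∀ d m, τ d m = side X Y (zext G m.1) d.fst d.snd := fun d m => rfl
  let C : Finset (Z →ₗ[ZMod 2] ZMod 2) := Finset.univ.image τ
  -- dimension bound
  have hrank : Module.finrank (ZMod 2) Z ≤ C.card := by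
    let Ψ : Z →ₗ[ZMod 2] (C → ZMod 2) := LinearMap.pi fun c => c.1
    have hinj : Function.Injective Ψ := by
      rw [← LinearMap.ker_eq_bot, LinearMap.ker_eq_bot']
      intro m hm
      have h0 : ∀ d, τ d m = 0 := by
        intro d
        exact congrFun hm ⟨τ d, Finset.mem_image_of_mem _ (Finset.mem_univ _)⟩
      ext ⟨e, he⟩
      induction e with
      | h a b =>
        have hab : G.Adj a b := he
        have := side_symm D (zext_symm m.1) (zext_nonadj m.1) (hZ m) hab
        have e1 := h0 ⟨(a, b), hab⟩
        have e2 := h0 ⟨(b, a), hab.symm⟩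
        rw [hτ] at e1 e2
        simp only at e1 e2
        rw [e1, e2, add_zero] at this
        simp only [zext, dif_pos hab] at this
        simpa using this.symm
    have := LinearMap.finrank_le_finrank_of_injective hinj
    simpa using this
  have hrn := LinearMap.finrank_range_add_finrank_ker (bdry G)
  have hlt := finrank_range_bdry_lt (G := G)
  have hE : Module.finrank (ZMod 2) (G.edgeSet → ZMod 2) = G.edgeFinset.card := by
    rw [Module.finrank_fintype_fun_eq_card, ← SimpleGraph.edgeFinset_card]
  rw [hE] at hrn
  -- counting darts
  have hfib : ∀ d : G.Dart, 8 ≤ (Finset.univ.filter fun d' => τ d' = τ d).card := by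
    apply fiber_ge_eight hg
    intro d
    have hd2 : ∃ w, w ≠ d.fst ∧ G.Adj d.snd w := by
      have : 1 < (G.neighborFinset d.snd).card := hdeg d.snd
      obtain ⟨w, hw, hne⟩ := Finset.exists_mem_ne this d.fst
      exact ⟨w, hne, by simpa using hw⟩
    obtain ⟨w, hw1, hw2, hw3⟩ := exists_next D d.adj.symm hd2
    refine ⟨⟨(d.snd, w), hw2⟩, rfl, hw1, ?_⟩
    ext m
    rw [hτ, hτ]
    exact (hw3 _ (zext_symm m.1) (zext_nonadj m.1) (hZ m)).symm
  have hdart : 8 * C.card ≤ 2 * G.edgeFinset.card := by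
    rw [← G.dart_card_eq_twice_card_edges]
    have h1 := Finset.card_eq_sum_card_image τ (Finset.univ : Finset G.Dart)
    rw [Finset.card_univ] at h1
    rw [h1, mul_comm, ← smul_eq_mul]
    refine Finset.card_nsmul_le_sum _ _ _ ?_
    intro c hc
    obtain ⟨d, -, rfl⟩ := Finset.mem_image.mp hc
    exact hfib d
  change _ + Module.finrank (ZMod 2) Z = _ at hrn
  omega

end Euler

section Reduce

section

variable {V : Type} [DecidableEq V]

lemma out_two {S N : Finset V} {a b : V} (hN : N = {a, b}) (ha : a ∈ S) : (N \ S).card ≤ 1 := by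
  rw [hN]
  refine (Finset.card_le_card (t := {b}) ?_).trans (by simp)
  intro y; simp only [Finset.mem_sdiff, Finset.mem_insert, Finset.mem_singleton]; grind

lemma out_three {S N : Finset V} {a b c : V} (hN : N = {a, b, c}) (ha : a ∈ S) (hb : b ∈ S) :
    (N \ S).card ≤ 1 := by
  rw [hN]
  refine (Finset.card_le_card (t := {c}) ?_).trans (by simp)
  intro y; simp only [Finset.mem_sdiff, Finset.mem_insert, Finset.mem_singleton]; grind

lemma out_zero {S N : Finset V} {a b c : V} (hN : N = {a, b, c}) (ha : a ∈ S) (hb : b ∈ S)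
    (hc : c ∈ S) : (N \ S).card = 0 := by
  rw [hN, Finset.card_eq_zero, Finset.sdiff_eq_empty_iff_subset]
  intro y; simp only [Finset.mem_insert, Finset.mem_singleton]; grind

lemma sum_two_le {N : Finset V} {a b : V} (hN : N = {a, b}) (f : V → ℕ) :
    ∑ t ∈ N, f t ≤ f a + f b := by
  rw [hN]
  by_cases h : a = b
  · subst h; simp
  · rw [Finset.sum_pair h]

lemma sum_three_le {N : Finset V} {a b c : V} (hN : N = {a, b, c}) (f : V → ℕ) :
    ∑ t ∈ N, f t ≤ f a + f b + f c := by
  rw [hN]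
  by_cases h : a ∈ ({b, c} : Finset V)
  · rw [Finset.insert_eq_of_mem h]
    have := sum_two_le (N := {b, c}) rfl f
    omega
  · rw [Finset.sum_insert h]
    have := sum_two_le (N := {b, c}) rfl f
    omega

end

variable {V : Type} [Fintype V] [DecidableEq V] {G : SimpleGraph V} [DecidableRel G.Adj]

/-- The graph obtained by deleting `S` has a colouring from the lists. -/
def ColorsOff (G : SimpleGraph V) (L : V → Finset ℕ) (S : Finset V) : Prop :=
  ∃ φ : V → ℕ, (∀ v, v ∉ S → φ v ∈ L v) ∧ ∀ u v, u ∉ S → v ∉ S → u ≠ v →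
    (G.Adj u v ∨ ∃ w, w ∉ S ∧ G.Adj u w ∧ G.Adj w v) → φ u ≠ φ v

/-- contribution of the neighbour `t` to the number of forbidden colours -/
def cost (G : SimpleGraph V) [DecidableRel G.Adj] (S : Finset V) (t : V) : ℕ :=
  if t ∈ S then (G.neighborFinset t \ S).card else G.degree t

/-- A minimal counterexample. -/
structure MinCE (G : SimpleGraph V) [DecidableRel G.Adj] (L : V → Finset ℕ) (D : ℕ) : Prop where
  girth : GirthEight G
  hD : 4 ≤ D
  deg : ∀ v, G.degree v ≤ D
  lists : ∀ v, D + 3 ≤ (L v).card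
  col : ∀ S : Finset V, S.Nonempty → ColorsOff G L S
  no : ¬ ∃ φ : V → ℕ, IsTwoDistListColoring G L φ

lemma TwoDistAdj.symm' {V : Type} {G : SimpleGraph V} {u v : V} (h : TwoDistAdj G u v) :
    TwoDistAdj G v u := by
  obtain ⟨h1, h2⟩ := h
  refine ⟨h1.symm, ?_⟩
  rcases h2 with h2 | ⟨w, h2, h3⟩
  · exact Or.inl h2.symm
  · exact Or.inr ⟨w, h3.symm, h2.symm⟩

lemma forb_card (S : Finset V) (s : V) (φ : V → ℕ) :
    ∃ F : Finset ℕ, (∀ t, t ∉ S → TwoDistAdj G s t → φ t ∈ F) ∧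
      F.card ≤ ∑ t ∈ G.neighborFinset s, cost G S t := by
  let K : V → Finset V := fun t =>
    if t ∈ S then G.neighborFinset t \ S else insert t ((G.neighborFinset t).erase s)
  refine ⟨((G.neighborFinset s).biUnion K).image φ, ?_, ?_⟩
  · intro t ht hst
    refine Finset.mem_image_of_mem _ ?_
    rw [Finset.mem_biUnion]
    obtain ⟨hne, h | ⟨w, h1, h2⟩⟩ := hst
    · refine ⟨t, by simpa using h, ?_⟩
      simp [K, ht]
    · refine ⟨w, by simpa using h1, ?_⟩
      by_cases hw : w ∈ S
      · simp [K, hw, ht, h2]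
      · simp [K, hw, h2, hne.symm]
  · refine Finset.card_image_le.trans (Finset.card_biUnion_le.trans ?_)
    refine Finset.sum_le_sum fun t ht => ?_
    have hst : G.Adj s t := by simpa using ht
    unfold cost
    simp only [K]
    split_ifs with h
    · exact le_rfl
    · refine (Finset.card_insert_le _ _).trans ?_
      rw [Finset.card_erase_of_mem (by simpa using hst.symm), SimpleGraph.card_neighborFinset_eq_degree]
      have : 0 < G.degree t := (G.degree_pos_iff_exists_adj t).mpr ⟨s, hst.symm⟩
      omega

variable {L : V → Finset ℕ} {D : ℕ}

lemma MinCE.cfg (M : MinCE G L D) (S : Finset V) (hS : S.Nonempty)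
    (hout : ∀ s ∈ S, (G.neighborFinset s \ S).card ≤ 1) :
    ∃ A : V → Finset ℕ, (∀ s ∈ S, D + 3 ≤ (A s).card + ∑ t ∈ G.neighborFinset s, cost G S t) ∧
      ∀ ψ : V → ℕ, (∀ s ∈ S, ψ s ∈ A s) →
        (∀ s ∈ S, ∀ t ∈ S, TwoDistAdj G s t → ψ s ≠ ψ t) → False := by
  obtain ⟨φ, hφ1, hφ2⟩ := M.col S hS
  have hF : ∀ s, ∃ F : Finset ℕ, s ∈ S → (∀ t, t ∉ S → TwoDistAdj G s t → φ t ∈ F) ∧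
      F.card ≤ ∑ t ∈ G.neighborFinset s, cost G S t := by
    intro s
    by_cases hs : s ∈ S
    · obtain ⟨F, hF⟩ := forb_card (G := G) S s φ
      exact ⟨F, fun _ => hF⟩
    · exact ⟨∅, fun h => absurd h hs⟩
  choose F hF using hF
  refine ⟨fun s => L s \ F s, ?_, ?_⟩
  · intro s hs
    have h1 := (hF s hs).2
    have h2 := M.lists s
    have h3 := Finset.le_card_sdiff (F s) (L s)
    dsimp only
    omega
  · intro ψ h1 h2
    apply M.no
    have hmix : ∀ u v, u ∈ S → v ∉ S → TwoDistAdj G u v → ψ u ≠ φ v := by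
      intro u v hu hv huv heq
      have := (Finset.mem_sdiff.mp (h1 u hu)).2
      rw [heq] at this
      exact this ((hF u hu).1 v hv huv)
    refine ⟨fun v => if v ∈ S then ψ v else φ v, ?_, ?_⟩
    · intro v
      by_cases hv : v ∈ S
      · simpa [hv] using (Finset.mem_sdiff.mp (h1 v hv)).1
      · simpa [hv] using hφ1 v hv
    · intro u v huv
      by_cases hu : u ∈ S <;> by_cases hv : v ∈ S <;> simp only [hu, hv, if_true, if_false]
      · exact h2 u hu v hv huv
      · exact hmix u v hu hv huv
      · exact (hmix v u hv hu huv.symm').symm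
      · refine hφ2 u v hu hv huv.1 ?_
        rcases huv.2 with h | ⟨w, hw1, hw2⟩
        · exact Or.inl h
        · by_cases hw : w ∈ S
          · exfalso
            have := Finset.card_le_one.mp (hout w hw) u (by simp [hu, hw1.symm]) v (by simp [hv, hw2])
            exact huv.1 this
          · exact Or.inr ⟨w, hw, hw1, hw2⟩

lemma MinCE.cost_le (M : MinCE G L D) (S : Finset V)
    (hout : ∀ s ∈ S, (G.neighborFinset s \ S).card ≤ 1) (t : V) : cost G S t ≤ D := by
  unfold cost
  split_ifs with h
  · have := hout t h
    have := M.hD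
    omega
  · exact M.deg t

lemma cost_mem {S : Finset V} {t : V} (ht : t ∈ S) : cost G S t = (G.neighborFinset t \ S).card :=
  if_pos ht

lemma deg_two {v u : V} (hd : G.degree u = 2) (h : G.Adj u v) :
    ∃ w, w ≠ v ∧ G.neighborFinset u = {v, w} := by
  rw [← SimpleGraph.card_neighborFinset_eq_degree, Finset.card_eq_two] at hd
  obtain ⟨a, b, hab, hN⟩ := hd
  have : v ∈ G.neighborFinset u := by simpa using h
  rw [hN] at this
  simp only [Finset.mem_insert, Finset.mem_singleton] at this
  rcases this with rfl | rfl
  · exact ⟨b, hab.symm, hN⟩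
  · exact ⟨a, hab, by rw [hN, Finset.pair_comm]⟩

lemma deg_three {v u : V} (hd : G.degree u = 3) (h : G.Adj u v) :
    ∃ a b, a ≠ v ∧ b ≠ v ∧ a ≠ b ∧ G.neighborFinset u = {v, a, b} := by
  have hv : v ∈ G.neighborFinset u := by simpa using h
  have : ((G.neighborFinset u).erase v).card = 2 := by
    rw [Finset.card_erase_of_mem hv, SimpleGraph.card_neighborFinset_eq_degree, hd]
  obtain ⟨a, b, hab, hN⟩ := Finset.card_eq_two.mp this
  refine ⟨a, b, ?_, ?_, hab, ?_⟩
  · have : a ∈ (G.neighborFinset u).erase v := by rw [hN]; simp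
    exact (Finset.mem_erase.mp this).1
  · have : b ∈ (G.neighborFinset u).erase v := by rw [hN]; simp
    exact (Finset.mem_erase.mp this).1
  · rw [← hN, Finset.insert_erase hv]

lemma pick0 {A : Finset ℕ} (h : 0 < A.card) : ∃ c, c ∈ A := Finset.card_pos.mp h

lemma pick1 {A : Finset ℕ} (x : ℕ) (h : 1 < A.card) : ∃ c ∈ A, c ≠ x :=
  Finset.exists_mem_ne h x

lemma pick2 {A : Finset ℕ} (x y : ℕ) (h : 2 < A.card) : ∃ c ∈ A, c ≠ x ∧ c ≠ y := by
  obtain ⟨c, hc, hn⟩ := Finset.exists_mem_notMem_of_card_lt_card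
    (lt_of_le_of_lt (Finset.card_le_two (a := x) (b := y)) h)
  exact ⟨c, hc, by simpa using hn⟩

lemma pick3 {A : Finset ℕ} (x y z : ℕ) (h : 3 < A.card) : ∃ c ∈ A, c ≠ x ∧ c ≠ y ∧ c ≠ z := by
  obtain ⟨c, hc, hn⟩ := Finset.exists_mem_notMem_of_card_lt_card
    (lt_of_le_of_lt (Finset.card_le_three (a := x) (b := y) (c := z)) h)
  exact ⟨c, hc, by simpa using hn⟩

/-- no vertices of degree at most one -/
lemma MinCE.two_le_degree (M : MinCE G L D) (v : V) : 2 ≤ G.degree v := by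
  by_contra hlt
  have hd : G.degree v ≤ 1 := by omega
  have hout : ∀ s ∈ ({v} : Finset V), (G.neighborFinset s \ {v}).card ≤ 1 := by
    intro s hs
    rw [Finset.mem_singleton] at hs
    subst hs
    exact (Finset.card_le_card Finset.sdiff_subset).trans hd
  obtain ⟨A, hA, hno⟩ := M.cfg {v} (by simp) hout
  have h1 := hA v (by simp)
  have h2 : ∑ t ∈ G.neighborFinset v, cost G {v} t ≤ D := by
    calc _ ≤ ∑ t ∈ G.neighborFinset v, D := Finset.sum_le_sum fun t _ => M.cost_le _ hout t
      _ = G.degree v * D := by simp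
      _ ≤ 1 * D := Nat.mul_le_mul_right _ hd
      _ = D := one_mul _
  obtain ⟨c, hc⟩ := pick0 (A := A v) (by omega)
  refine hno (fun _ => c) (by simpa using hc) ?_
  intro s hs t ht hst
  rw [Finset.mem_singleton] at hs ht
  exact absurd (hs.trans ht.symm) hst.1

/-- no adjacent vertices of degree two -/
lemma MinCE.no_adj_two (M : MinCE G L D) {u v : V} (h : G.Adj u v) (hu : G.degree u = 2)
    (hv : G.degree v = 2) : False := by
  obtain ⟨t, -, hNu⟩ := deg_two hu h
  obtain ⟨w, -, hNv⟩ := deg_two hv h.symm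
  set S : Finset V := {u, v} with hS
  have huS : u ∈ S := by simp [hS]
  have hvS : v ∈ S := by simp [hS]
  have hout : ∀ s ∈ S, (G.neighborFinset s \ S).card ≤ 1 := by
    intro s hs
    simp only [hS, Finset.mem_insert, Finset.mem_singleton] at hs
    rcases hs with rfl | rfl
    · exact out_two hNu hvS
    · exact out_two hNv huS
  obtain ⟨A, hA, hno⟩ := M.cfg S ⟨u, huS⟩ hout
  have hcu : cost G S u ≤ 1 := by rw [cost_mem huS]; exact hout u huS
  have hcv : cost G S v ≤ 1 := by rw [cost_mem hvS]; exact hout v hvS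
  have h1 := hA u huS
  have h2 := hA v hvS
  have h3 := sum_two_le hNu (cost G S)
  have h4 := sum_two_le hNv (cost G S)
  have h5 := M.cost_le S hout t
  have h6 := M.cost_le S hout w
  obtain ⟨cu, hcu⟩ := pick0 (A := A u) (by omega)
  obtain ⟨cv, hcv, hne⟩ := pick1 (A := A v) cu (by omega)
  have huv := h.ne
  obtain ⟨ψ, p1, p2⟩ : ∃ ψ : V → ℕ, ψ u = cu ∧ ψ v = cv :=
    ⟨fun y => if y = u then cu else cv, by grind, by grind⟩
  refine hno ψ ?_ ?_
  · intro s hs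
    simp only [hS, Finset.mem_insert, Finset.mem_singleton] at hs
    grind
  · intro s hs t ht hst
    have := hst.1
    simp only [hS, Finset.mem_insert, Finset.mem_singleton] at hs ht
    grind

/-- no 3-vertex with three 2-neighbours -/
lemma MinCE.no_three_two (M : MinCE G L D) {v a b c : V} (hN : G.neighborFinset v = {a, b, c})
    (hab : a ≠ b) (hac : a ≠ c) (hbc : b ≠ c)
    (ha : G.degree a = 2) (hb : G.degree b = 2) (hc : G.degree c = 2) : False := by
  have hva : G.Adj v a := by rw [← mem_neighborFinset, hN]; simp
  have hvb : G.Adj v b := by rw [← mem_neighborFinset, hN]; simp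
  have hvc : G.Adj v c := by rw [← mem_neighborFinset, hN]; simp
  obtain ⟨a', -, hNa⟩ := deg_two ha hva.symm
  obtain ⟨b', -, hNb⟩ := deg_two hb hvb.symm
  obtain ⟨c', -, hNc⟩ := deg_two hc hvc.symm
  set S : Finset V := {v, a, b, c} with hS
  have hvS : v ∈ S := by simp [hS]
  have haS : a ∈ S := by simp [hS]
  have hbS : b ∈ S := by simp [hS]
  have hcS : c ∈ S := by simp [hS]
  have hv0 : (G.neighborFinset v \ S).card = 0 := out_zero hN haS hbS hcS
  have hout : ∀ s ∈ S, (G.neighborFinset s \ S).card ≤ 1 := by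
    intro s hs
    simp only [hS, Finset.mem_insert, Finset.mem_singleton] at hs
    rcases hs with rfl | rfl | rfl | rfl
    · omega
    · exact out_two hNa hvS
    · exact out_two hNb hvS
    · exact out_two hNc hvS
  obtain ⟨A, hA, hno⟩ := M.cfg S ⟨v, hvS⟩ hout
  have kv : cost G S v = 0 := by rw [cost_mem hvS]; exact hv0
  have ka : cost G S a ≤ 1 := by rw [cost_mem haS]; exact hout a haS
  have kb : cost G S b ≤ 1 := by rw [cost_mem hbS]; exact hout b hbS
  have kc : cost G S c ≤ 1 := by rw [cost_mem hcS]; exact hout c hcS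
  have ka' := M.cost_le S hout a'
  have kb' := M.cost_le S hout b'
  have kc' := M.cost_le S hout c'
  have hD := M.hD
  have hAv : 3 < (A v).card := by
    have := hA v hvS; have := sum_three_le hN (cost G S); omega
  have hAa : 2 < (A a).card := by
    have := hA a haS; have := sum_two_le hNa (cost G S); omega
  have hAb : 2 < (A b).card := by
    have := hA b hbS; have := sum_two_le hNb (cost G S); omega
  have hAc : 2 < (A c).card := by
    have := hA c hcS; have := sum_two_le hNc (cost G S); omega
  obtain ⟨xa, ma⟩ := pick0 (A := A a) (by omega)
  obtain ⟨xb, mb, n1⟩ := pick1 (A := A b) xa (by omega)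
  obtain ⟨xc, mc, n2, n3⟩ := pick2 (A := A c) xa xb (by omega)
  obtain ⟨xv, mv, n4, n5, n6⟩ := pick3 (A := A v) xa xb xc (by omega)
  have d1 := hva.ne
  have d2 := hvb.ne
  have d3 := hvc.ne
  obtain ⟨ψ, p1, p2, p3, p4⟩ : ∃ ψ : V → ℕ, ψ v = xv ∧ ψ a = xa ∧ ψ b = xb ∧ ψ c = xc :=
    ⟨fun y => if y = v then xv else if y = a then xa else if y = b then xb else xc,
      by grind, by grind, by grind, by grind⟩
  refine hno ψ ?_ ?_
  · intro s hs
    simp only [hS, Finset.mem_insert, Finset.mem_singleton] at hs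
    clear hN hNa hNb hNc hS
    grind
  · intro s hs t ht hst
    have := hst.1
    simp only [hS, Finset.mem_insert, Finset.mem_singleton] at hs ht
    clear hN hNa hNb hNc hS
    grind

end Reduce

section Reduce2

lemma list_five {A1 A2 Av Ax Ay : Finset ℕ} (h1 : 2 < A1.card) (h2 : 2 < A2.card)
    (hv : 3 < Av.card) (hx : 1 < Ax.card) (hy : 1 < Ay.card) :
    ∃ c1 ∈ A1, ∃ c2 ∈ A2, ∃ cv ∈ Av, ∃ cx ∈ Ax, ∃ cy ∈ Ay,
      c1 ≠ c2 ∧ c1 ≠ cv ∧ c1 ≠ cx ∧ c2 ≠ cv ∧ c2 ≠ cx ∧ cv ≠ cx ∧ cy ≠ cx ∧ cy ≠ cv := by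
  by_cases e1 : ∃ c ∈ Ay, c ∈ A1
  · obtain ⟨c, hc, hc1⟩ := e1
    obtain ⟨cx, mx, n1⟩ := pick1 (A := Ax) c (by omega)
    obtain ⟨c2, m2, n2, n3⟩ := pick2 (A := A2) c cx (by omega)
    obtain ⟨cv, mv, n4, n5, n6⟩ := pick3 (A := Av) c cx c2 (by omega)
    exact ⟨c, hc1, c2, m2, cv, mv, cx, mx, c, hc, by grind⟩
  by_cases e2 : ∃ c ∈ Ay, c ∈ A2
  · obtain ⟨c, hc, hc1⟩ := e2
    obtain ⟨cx, mx, n1⟩ := pick1 (A := Ax) c (by omega)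
    obtain ⟨c2, m2, n2, n3⟩ := pick2 (A := A1) c cx (by omega)
    obtain ⟨cv, mv, n4, n5, n6⟩ := pick3 (A := Av) c cx c2 (by omega)
    exact ⟨c2, m2, c, hc1, cv, mv, cx, mx, c, hc, by grind⟩
  push Not at e1 e2
  by_cases e3 : ∃ c ∈ Ay, c ∉ Av
  · obtain ⟨c, hc, hcv⟩ := e3
    obtain ⟨cx, mx, n1⟩ := pick1 (A := Ax) c (by omega)
    obtain ⟨c1, m1, n2⟩ := pick1 (A := A1) cx (by omega)
    obtain ⟨c2, m2, n3, n4⟩ := pick2 (A := A2) cx c1 (by omega)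
    obtain ⟨cv, mv, n5, n6, n7⟩ := pick3 (A := Av) cx c1 c2 (by omega)
    exact ⟨c1, m1, c2, m2, cv, mv, cx, mx, c, hc, by grind⟩
  push Not at e3
  by_cases e4 : ∃ a ∈ Ax, a ∉ Ay
  · obtain ⟨a, ha, hay⟩ := e4
    obtain ⟨d, hd⟩ := pick0 (A := Ay) (by omega)
    obtain ⟨c, hc, hcd⟩ := pick1 (A := Ay) d (by omega)
    obtain ⟨c2, m2, n2⟩ := pick1 (A := A2) a (by omega)
    obtain ⟨c1, m1, n3, n4⟩ := pick2 (A := A1) a c2 (by omega)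
    exact ⟨c1, m1, c2, m2, d, e3 d hd, a, ha, c, hc, by grind⟩
  push Not at e4
  obtain ⟨a, ha⟩ := pick0 (A := Ax) (by omega)
  obtain ⟨c, hc, hca⟩ := pick1 (A := Ay) a (by omega)
  obtain ⟨cv, mv, n1, n2⟩ := pick2 (A := Av) a c (by omega)
  obtain ⟨c1, m1, n3⟩ := pick1 (A := A1) cv (by omega)
  obtain ⟨c2, m2, n4, n5⟩ := pick2 (A := A2) cv c1 (by omega)
  exact ⟨c1, m1, c2, m2, cv, mv, a, ha, c, hc, by grind⟩

lemma list_seven {A1 A2 Av Ax B1 B2 Bv : Finset ℕ} (h1 : 2 < A1.card) (h2 : 2 < A2.card)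
    (hv : 3 < Av.card) (hx : 3 < Ax.card) (k1 : 2 < B1.card) (k2 : 2 < B2.card)
    (kv : 3 < Bv.card) :
    ∃ c1 ∈ A1, ∃ c2 ∈ A2, ∃ cv ∈ Av, ∃ cx ∈ Ax, ∃ b1 ∈ B1, ∃ b2 ∈ B2, ∃ bv ∈ Bv,
      c1 ≠ c2 ∧ c1 ≠ cv ∧ c1 ≠ cx ∧ c2 ≠ cv ∧ c2 ≠ cx ∧ cv ≠ cx ∧
      b1 ≠ b2 ∧ b1 ≠ bv ∧ b1 ≠ cx ∧ b2 ≠ bv ∧ b2 ≠ cx ∧ bv ≠ cx ∧ cv ≠ bv := by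
  obtain ⟨T, hT, hT3⟩ := Finset.exists_subset_card_eq (show 3 ≤ A1.card by omega)
  obtain ⟨cx, mx, nx⟩ := Finset.exists_mem_notMem_of_card_lt_card (show T.card < Ax.card by omega)
  obtain ⟨b1, mb1, n1⟩ := pick1 (A := B1) cx (by omega)
  obtain ⟨b2, mb2, n2, n3⟩ := pick2 (A := B2) cx b1 (by omega)
  obtain ⟨bv, mbv, n4, n5, n6⟩ := pick3 (A := Bv) cx b1 b2 (by omega)
  obtain ⟨cv, mv, n7, n8⟩ := pick2 (A := Av) cx bv (by omega)
  obtain ⟨c2, m2, n9, n10⟩ := pick2 (A := A2) cx cv (by omega)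
  obtain ⟨c1, m1, n11, n12⟩ := pick2 (A := T) cv c2 (by omega)
  exact ⟨c1, hT m1, c2, m2, cv, mv, cx, mx, b1, mb1, b2, mb2, bv, mbv, by grind⟩

lemma GirthEight.far3 {V : Type} {G : SimpleGraph V} (hg : GirthEight G) {a b c d : V}
    (h1 : G.Adj a b) (h2 : G.Adj b c) (h3 : G.Adj c d) (hac : a ≠ c) (hbd : b ≠ d) :
    ¬ TwoDistAdj G a d := by
  rintro ⟨hne, h | ⟨m, h, h'⟩⟩
  · exact hg.no4 h1 h2 h3 h.symm hac hbd
  · exact hg.no5 h1 h2 h3 h'.symm h.symm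

lemma GirthEight.far4 {V : Type} {G : SimpleGraph V} (hg : GirthEight G) {a b c d e : V}
    (h1 : G.Adj a b) (h2 : G.Adj b c) (h3 : G.Adj c d) (h4 : G.Adj d e)
    (hac : a ≠ c) (hbd : b ≠ d) (hce : c ≠ e) : ¬ TwoDistAdj G a e := by
  rintro ⟨hne, h | ⟨m, h, h'⟩⟩
  · exact hg.no5 h1 h2 h3 h4 h.symm
  · exact hg.no6 h1 h2 h3 h4 h'.symm h.symm hac hbd hce

variable {V : Type} [Fintype V] [DecidableEq V] {G : SimpleGraph V} [DecidableRel G.Adj]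
  {L : V → Finset ℕ} {D : ℕ}

/-- no bad 3-vertex next to a 3-vertex with a 2-neighbour -/
lemma MinCE.no_bad_next (M : MinCE G L D) {v u1 u2 x y : V}
    (hN : G.neighborFinset v = {u1, u2, x}) (h12 : u1 ≠ u2) (h1x : u1 ≠ x) (h2x : u2 ≠ x)
    (hd1 : G.degree u1 = 2) (hd2 : G.degree u2 = 2) (hdx : G.degree x = 3)
    (hxy : G.Adj x y) (hyd : G.degree y = 2) (hyv : y ≠ v) : False := by
  have hv1 : G.Adj v u1 := by rw [← mem_neighborFinset, hN]; simp
  have hv2 : G.Adj v u2 := by rw [← mem_neighborFinset, hN]; simp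
  have hvx : G.Adj v x := by rw [← mem_neighborFinset, hN]; simp
  obtain ⟨w1, -, hN1⟩ := deg_two hd1 hv1.symm
  obtain ⟨w2, -, hN2⟩ := deg_two hd2 hv2.symm
  obtain ⟨y', -, hNy⟩ := deg_two hyd hxy.symm
  obtain ⟨z, hNx⟩ : ∃ z, G.neighborFinset x = {v, y, z} := by
    obtain ⟨a, b, -, -, -, hNx⟩ := deg_three hdx hvx.symm
    have : y ∈ G.neighborFinset x := by simpa using hxy
    rw [hNx] at this
    simp only [Finset.mem_insert, Finset.mem_singleton] at this
    rcases this with rfl | rfl | rfl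
    · exact absurd rfl hyv
    · exact ⟨b, hNx⟩
    · exact ⟨a, by rw [hNx, Finset.pair_comm]⟩
  have f1 : ¬ TwoDistAdj G u1 y := M.girth.far3 hv1.symm hvx hxy h1x hyv.symm
  have f2 : ¬ TwoDistAdj G u2 y := M.girth.far3 hv2.symm hvx hxy h2x hyv.symm
  have f1' : ¬ TwoDistAdj G y u1 := fun h => f1 h.symm'
  have f2' : ¬ TwoDistAdj G y u2 := fun h => f2 h.symm'
  have d1 := hv1.ne
  have d2 := hv2.ne
  have d3 := hvx.ne
  have d4 := hxy.ne
  have d5 : u1 ≠ y := by rintro rfl; exact M.girth.no3 hv1.symm hvx hxy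
  have d6 : u2 ≠ y := by rintro rfl; exact M.girth.no3 hv2.symm hvx hxy
  set S : Finset V := {u1, u2, v, x, y} with hS
  have s1 : u1 ∈ S := by simp [hS]
  have s2 : u2 ∈ S := by simp [hS]
  have sv : v ∈ S := by simp [hS]
  have sx : x ∈ S := by simp [hS]
  have sy : y ∈ S := by simp [hS]
  have hv0 : (G.neighborFinset v \ S).card = 0 := out_zero hN s1 s2 sx
  have hout : ∀ s ∈ S, (G.neighborFinset s \ S).card ≤ 1 := by
    intro s hs
    simp only [hS, Finset.mem_insert, Finset.mem_singleton] at hs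
    rcases hs with rfl | rfl | rfl | rfl | rfl
    · exact out_two hN1 sv
    · exact out_two hN2 sv
    · omega
    · exact out_three hNx sv sy
    · exact out_two hNy sx
  obtain ⟨A, hA, hno⟩ := M.cfg S ⟨v, sv⟩ hout
  have kv : cost G S v = 0 := by rw [cost_mem sv]; exact hv0
  have k1 : cost G S u1 ≤ 1 := by rw [cost_mem s1]; exact hout _ s1
  have k2 : cost G S u2 ≤ 1 := by rw [cost_mem s2]; exact hout _ s2
  have kx : cost G S x ≤ 1 := by rw [cost_mem sx]; exact hout _ sx
  have ky : cost G S y ≤ 1 := by rw [cost_mem sy]; exact hout _ sy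
  have kw1 := M.cost_le S hout w1
  have kw2 := M.cost_le S hout w2
  have ky' := M.cost_le S hout y'
  have kz := M.cost_le S hout z
  have hD := M.hD
  have a1 : 2 < (A u1).card := by
    have := hA u1 s1; have := sum_two_le hN1 (cost G S); omega
  have a2 : 2 < (A u2).card := by
    have := hA u2 s2; have := sum_two_le hN2 (cost G S); omega
  have av : 3 < (A v).card := by
    have := hA v sv; have := sum_three_le hN (cost G S); omega
  have ax : 1 < (A x).card := by
    have := hA x sx; have := sum_three_le hNx (cost G S); omega
  have ay : 1 < (A y).card := by
    have := hA y sy; have := sum_two_le hNy (cost G S); omega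
  obtain ⟨c1, m1, c2, m2, cv, mv, cx, mx, cy, my, n1, n2, n3, n4, n5, n6, n7, n8⟩ :=
    list_five a1 a2 av ax ay
  obtain ⟨ψ, p1, p2, p3, p4, p5⟩ : ∃ ψ : V → ℕ,
      ψ u1 = c1 ∧ ψ u2 = c2 ∧ ψ v = cv ∧ ψ x = cx ∧ ψ y = cy :=
    ⟨fun t => if t = u1 then c1 else if t = u2 then c2 else if t = v then cv else
      if t = x then cx else cy, by grind, by grind, by grind, by grind, by grind⟩
  refine hno ψ ?_ ?_
  · intro s hs
    simp only [hS, Finset.mem_insert, Finset.mem_singleton] at hs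
    rcases hs with rfl | rfl | rfl | rfl | rfl
    · rwa [p1]
    · rwa [p2]
    · rwa [p3]
    · rwa [p4]
    · rwa [p5]
  · intro s hs t ht hst
    have := hst.1
    simp only [hS, Finset.mem_insert, Finset.mem_singleton] at hs ht
    clear hN hN1 hN2 hNx hNy hS hno hA hout
    grind

/-- no 3-vertex with two bad neighbours and a third neighbour of degree at most three -/
lemma MinCE.no_two_bad (M : MinCE G L D) {x v v' z u1 u2 t1 t2 : V}
    (hNx : G.neighborFinset x = {v, v', z}) (hvv' : v ≠ v') (hz : G.degree z ≤ 3)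
    (hN : G.neighborFinset v = {u1, u2, x}) (h12 : u1 ≠ u2) (h1x : u1 ≠ x) (h2x : u2 ≠ x)
    (hd1 : G.degree u1 = 2) (hd2 : G.degree u2 = 2)
    (hN' : G.neighborFinset v' = {t1, t2, x}) (h12' : t1 ≠ t2) (h1x' : t1 ≠ x) (h2x' : t2 ≠ x)
    (hd1' : G.degree t1 = 2) (hd2' : G.degree t2 = 2) : False := by
  have hv1 : G.Adj v u1 := by rw [← mem_neighborFinset, hN]; simp
  have hv2 : G.Adj v u2 := by rw [← mem_neighborFinset, hN]; simp
  have hvx : G.Adj v x := by rw [← mem_neighborFinset, hN]; simp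
  have hv1' : G.Adj v' t1 := by rw [← mem_neighborFinset, hN']; simp
  have hv2' : G.Adj v' t2 := by rw [← mem_neighborFinset, hN']; simp
  have hvx' : G.Adj v' x := by rw [← mem_neighborFinset, hN']; simp
  obtain ⟨w1, -, hN1⟩ := deg_two hd1 hv1.symm
  obtain ⟨w2, -, hN2⟩ := deg_two hd2 hv2.symm
  obtain ⟨w1', -, hN1'⟩ := deg_two hd1' hv1'.symm
  obtain ⟨w2', -, hN2'⟩ := deg_two hd2' hv2'.symm
  have hg := M.girth
  have f1 : ¬ TwoDistAdj G u1 v' := hg.far3 hv1.symm hvx hvx'.symm h1x hvv'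
  have f2 : ¬ TwoDistAdj G u2 v' := hg.far3 hv2.symm hvx hvx'.symm h2x hvv'
  have f3 : ¬ TwoDistAdj G t1 v := hg.far3 hv1'.symm hvx' hvx.symm h1x' hvv'.symm
  have f4 : ¬ TwoDistAdj G t2 v := hg.far3 hv2'.symm hvx' hvx.symm h2x' hvv'.symm
  have f5 : ¬ TwoDistAdj G u1 t1 := hg.far4 hv1.symm hvx hvx'.symm hv1' h1x hvv' h1x'.symm
  have f6 : ¬ TwoDistAdj G u1 t2 := hg.far4 hv1.symm hvx hvx'.symm hv2' h1x hvv' h2x'.symm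
  have f7 : ¬ TwoDistAdj G u2 t1 := hg.far4 hv2.symm hvx hvx'.symm hv1' h2x hvv' h1x'.symm
  have f8 : ¬ TwoDistAdj G u2 t2 := hg.far4 hv2.symm hvx hvx'.symm hv2' h2x hvv' h2x'.symm
  have g1 : ¬ TwoDistAdj G v' u1 := fun h => f1 h.symm'
  have g2 : ¬ TwoDistAdj G v' u2 := fun h => f2 h.symm'
  have g3 : ¬ TwoDistAdj G v t1 := fun h => f3 h.symm'
  have g4 : ¬ TwoDistAdj G v t2 := fun h => f4 h.symm'
  have g5 : ¬ TwoDistAdj G t1 u1 := fun h => f5 h.symm'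
  have g6 : ¬ TwoDistAdj G t2 u1 := fun h => f6 h.symm'
  have g7 : ¬ TwoDistAdj G t1 u2 := fun h => f7 h.symm'
  have g8 : ¬ TwoDistAdj G t2 u2 := fun h => f8 h.symm'
  have d1 := hv1.ne
  have d2 := hv2.ne
  have d3 := hvx.ne
  have d1' := hv1'.ne
  have d2' := hv2'.ne
  have d3' := hvx'.ne
  have hn4 : ∀ u t, G.Adj v u → G.Adj v' t → u ≠ x → u ≠ t := by
    rintro u t h1 h2 hne rfl
    exact hg.no4 h1.symm hvx hvx'.symm h2 hne hvv'
  have d4 := hn4 _ _ hv1 hv1' h1x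
  have d5 := hn4 _ _ hv1 hv2' h1x
  have d6 := hn4 _ _ hv2 hv1' h2x
  have d7 := hn4 _ _ hv2 hv2' h2x
  have hn3 : ¬ G.Adj v v' := fun h => hg.no3 h hvx' hvx.symm
  have d8 : u1 ≠ v' := by rintro rfl; exact hn3 hv1
  have d9 : u2 ≠ v' := by rintro rfl; exact hn3 hv2
  have d10 : t1 ≠ v := by rintro rfl; exact hn3 hv1'.symm
  have d11 : t2 ≠ v := by rintro rfl; exact hn3 hv2'.symm
  set S : Finset V := {u1, u2, v, x, t1, t2, v'} with hS
  have s1 : u1 ∈ S := by simp [hS]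
  have s2 : u2 ∈ S := by simp [hS]
  have sv : v ∈ S := by simp [hS]
  have sx : x ∈ S := by simp [hS]
  have s1' : t1 ∈ S := by simp [hS]
  have s2' : t2 ∈ S := by simp [hS]
  have sv' : v' ∈ S := by simp [hS]
  have hv0 : (G.neighborFinset v \ S).card = 0 := out_zero hN s1 s2 sx
  have hv0' : (G.neighborFinset v' \ S).card = 0 := out_zero hN' s1' s2' sx
  have hout : ∀ s ∈ S, (G.neighborFinset s \ S).card ≤ 1 := by
    intro s hs
    simp only [hS, Finset.mem_insert, Finset.mem_singleton] at hs
    rcases hs with rfl | rfl | rfl | rfl | rfl | rfl | rfl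
    · exact out_two hN1 sv
    · exact out_two hN2 sv
    · omega
    · exact out_three hNx sv sv'
    · exact out_two hN1' sv'
    · exact out_two hN2' sv'
    · omega
  obtain ⟨A, hA, hno⟩ := M.cfg S ⟨v, sv⟩ hout
  have kv : cost G S v = 0 := by rw [cost_mem sv]; exact hv0
  have kv' : cost G S v' = 0 := by rw [cost_mem sv']; exact hv0'
  have k1 : cost G S u1 ≤ 1 := by rw [cost_mem s1]; exact hout _ s1
  have k2 : cost G S u2 ≤ 1 := by rw [cost_mem s2]; exact hout _ s2
  have k1' : cost G S t1 ≤ 1 := by rw [cost_mem s1']; exact hout _ s1'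
  have k2' : cost G S t2 ≤ 1 := by rw [cost_mem s2']; exact hout _ s2'
  have kx : cost G S x ≤ 1 := by rw [cost_mem sx]; exact hout _ sx
  have kz : cost G S z ≤ 3 := by
    unfold cost
    split_ifs with h
    · have := hout z h; omega
    · exact hz
  have kw1 := M.cost_le S hout w1
  have kw2 := M.cost_le S hout w2
  have kw1' := M.cost_le S hout w1'
  have kw2' := M.cost_le S hout w2'
  have hD := M.hD
  have a1 : 2 < (A u1).card := by
    have := hA u1 s1; have := sum_two_le hN1 (cost G S); omega
  have a2 : 2 < (A u2).card := by
    have := hA u2 s2; have := sum_two_le hN2 (cost G S); omega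
  have av : 3 < (A v).card := by
    have := hA v sv; have := sum_three_le hN (cost G S); omega
  have ax : 3 < (A x).card := by
    have := hA x sx; have := sum_three_le hNx (cost G S); omega
  have a1' : 2 < (A t1).card := by
    have := hA t1 s1'; have := sum_two_le hN1' (cost G S); omega
  have a2' : 2 < (A t2).card := by
    have := hA t2 s2'; have := sum_two_le hN2' (cost G S); omega
  have av' : 3 < (A v').card := by
    have := hA v' sv'; have := sum_three_le hN' (cost G S); omega
  obtain ⟨c1, m1, c2, m2, cv, mv, cx, mx, b1, mb1, b2, mb2, bv, mbv, n1, n2, n3, n4, n5, n6, n7,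
    n8, n9, n10, n11, n12, n13⟩ := list_seven a1 a2 av ax a1' a2' av'
  obtain ⟨ψ, p1, p2, p3, p4, p5, p6, p7⟩ : ∃ ψ : V → ℕ,
      ψ u1 = c1 ∧ ψ u2 = c2 ∧ ψ v = cv ∧ ψ x = cx ∧ ψ t1 = b1 ∧ ψ t2 = b2 ∧ ψ v' = bv :=
    ⟨fun t => if t = u1 then c1 else if t = u2 then c2 else if t = v then cv else
      if t = x then cx else if t = t1 then b1 else if t = t2 then b2 else bv,
      by grind, by grind, by grind, by grind, by grind, by grind, by grind⟩
  refine hno ψ ?_ ?_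
  · intro s hs
    simp only [hS, Finset.mem_insert, Finset.mem_singleton] at hs
    rcases hs with rfl | rfl | rfl | rfl | rfl | rfl | rfl
    · rwa [p1]
    · rwa [p2]
    · rwa [p3]
    · rwa [p4]
    · rwa [p5]
    · rwa [p6]
    · rwa [p7]
  · intro s hs t ht hst
    have hne := hst.1
    simp only [hS, Finset.mem_insert, Finset.mem_singleton] at hs ht
    clear hN hN1 hN2 hNx hN' hN1' hN2' hS hno hA hout
    rcases hs with rfl | rfl | rfl | rfl | rfl | rfl | rfl <;>
      rcases ht with rfl | rfl | rfl | rfl | rfl | rfl | rfl <;>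
      first
        | exact absurd rfl hne
        | (exact absurd hst (by assumption))
        | (simp only [p1, p2, p3, p4, p5, p6, p7]; first | assumption | (apply Ne.symm; assumption))

end Reduce2

section Discharge

variable {V : Type} [Fintype V] [DecidableEq V] {G : SimpleGraph V} [DecidableRel G.Adj]
variable {L : V → Finset ℕ} {D : ℕ}

/-- A vertex of degree three with two neighbours of degree two. -/
def Bad (G : SimpleGraph V) [DecidableRel G.Adj] (v : V) : Prop :=
  G.degree v = 3 ∧ ∃ a b, a ≠ b ∧ G.Adj v a ∧ G.Adj v b ∧ G.degree a = 2 ∧ G.degree b = 2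

lemma Bad.nbhd {v x : V} (h : Bad G v) (hx : G.Adj v x) (hd : G.degree x ≠ 2) :
    ∃ u1 u2, G.neighborFinset v = {u1, u2, x} ∧ u1 ≠ u2 ∧ u1 ≠ x ∧ u2 ≠ x ∧
      G.degree u1 = 2 ∧ G.degree u2 = 2 := by
  obtain ⟨h3, a, b, hab, ha, hb, hda, hdb⟩ := h
  have hax : a ≠ x := by rintro rfl; exact hd hda
  have hbx : b ≠ x := by rintro rfl; exact hd hdb
  refine ⟨a, b, ?_, hab, hax, hbx, hda, hdb⟩
  symm
  apply Finset.eq_of_subset_of_card_le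
  · intro y hy
    simp only [Finset.mem_insert, Finset.mem_singleton] at hy
    rw [mem_neighborFinset]
    rcases hy with rfl | rfl | rfl <;> assumption
  · rw [card_neighborFinset_eq_degree, h3, Finset.card_eq_three.mpr ⟨a, b, x, hab, hax, hbx, rfl⟩]

lemma MinCE.bad_no_two (M : MinCE G L D) {x t y : V} (ht : Bad G t) (hxt : G.Adj x t)
    (hx : G.degree x = 3) (hxy : G.Adj x y) (hy : G.degree y = 2) : False := by
  obtain ⟨u1, u2, hN, h12, h1, h2, hd1, hd2⟩ := ht.nbhd hxt.symm (by omega)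
  refine M.no_bad_next hN h12 h1 h2 hd1 hd2 hx hxy hy ?_
  rintro rfl
  have := ht.1
  omega

lemma MinCE.bad_bad (M : MinCE G L D) {x a b c : V} (hx : G.neighborFinset x = {a, b, c})
    (hd : G.degree x = 3) (hab : a ≠ b) (ha : Bad G a) (hb : Bad G b) : 4 ≤ G.degree c := by
  by_contra hc
  have hxa : G.Adj x a := by rw [← mem_neighborFinset, hx]; simp
  have hxb : G.Adj x b := by rw [← mem_neighborFinset, hx]; simp
  obtain ⟨u1, u2, hN, h12, h1, h2, hd1, hd2⟩ := ha.nbhd hxa.symm (by omega)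
  obtain ⟨t1, t2, hN', h12', h1', h2', hd1', hd2'⟩ := hb.nbhd hxb.symm (by omega)
  exact M.no_two_bad hx hab (by omega) hN h12 h1 h2 hd1 hd2 hN' h12' h1' h2' hd1' hd2'

open Classical in
/-- Charge sent from `u` to its neighbour `v`. -/
noncomputable def give (G : SimpleGraph V) [DecidableRel G.Adj] (u v : V) : ℤ :=
  if 4 ≤ G.degree u then 1 else if G.degree u = 3 ∧ (G.degree v = 2 ∨ Bad G v) then 1 else 0

set_option linter.unusedSectionVars false in
lemma give_nonneg (u v : V) : 0 ≤ give G u v := by unfold give; split_ifs <;> simp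
set_option linter.unusedSectionVars false in
lemma give_le_one (u v : V) : give G u v ≤ 1 := by unfold give; split_ifs <;> simp

set_option maxHeartbeats 4000000 in
lemma MinCE.final_three (M : MinCE G L D) {x : V} (hd : G.degree x = 3) :
    0 ≤ 3 * (G.degree x : ℤ) - 8 + ∑ u ∈ G.neighborFinset x, (give G u x - give G x u) := by
  obtain ⟨a, b, c, hab, hac, hbc, hN⟩ := Finset.card_eq_three.mp
    ((card_neighborFinset_eq_degree G x).trans hd)
  have hxa : G.Adj x a := by rw [← mem_neighborFinset, hN]; simp
  have hxb : G.Adj x b := by rw [← mem_neighborFinset, hN]; simp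
  have hxc : G.Adj x c := by rw [← mem_neighborFinset, hN]; simp
  have hsum : ∑ u ∈ G.neighborFinset x, (give G u x - give G x u) =
      (give G a x - give G x a) + (give G b x - give G x b) + (give G c x - give G x c) := by
    rw [hN, Finset.sum_insert (by simp [hab, hac]), Finset.sum_pair hbc]; ring
  rw [hsum, hd]
  have f1 : ¬ (G.degree a = 2 ∧ G.degree b = 2 ∧ G.degree c = 2) :=
    fun ⟨h1, h2, h3⟩ => M.no_three_two hN hab hac hbc h1 h2 h3
  have f2 : ∀ t y, G.Adj x t → G.Adj x y → G.degree y = 2 → ¬ Bad G t :=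
    fun t y h1 h2 h3 h4 => M.bad_no_two h4 h1 hd h2 h3
  have fab : Bad G a → Bad G b → 4 ≤ G.degree c := M.bad_bad hN hd hab
  have fac : Bad G a → Bad G c → 4 ≤ G.degree b :=
    M.bad_bad (by rw [hN]; congr 1; exact Finset.pair_comm b c) hd hac
  have fbc : Bad G b → Bad G c → 4 ≤ G.degree a :=
    M.bad_bad (by rw [hN]; ext; simp; tauto) hd hbc
  have gab : G.degree a = 2 → G.degree b = 2 → Bad G x := fun h1 h2 => ⟨hd, a, b, hab, hxa, hxb, h1, h2⟩
  have gac : G.degree a = 2 → G.degree c = 2 → Bad G x := fun h1 h2 => ⟨hd, a, c, hac, hxa, hxc, h1, h2⟩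
  have gbc : G.degree b = 2 → G.degree c = 2 → Bad G x := fun h1 h2 => ⟨hd, b, c, hbc, hxb, hxc, h1, h2⟩
  have d3 : ∀ t, Bad G t → G.degree t = 3 := fun t h => h.1
  have ta := M.two_le_degree a
  have tb := M.two_le_degree b
  have tc := M.two_le_degree c
  have net : ∀ t, G.Adj x t → 2 ≤ G.degree t →
      (G.degree t = 2 ∧ give G t x - give G x t = -1) ∨
      (4 ≤ G.degree t ∧ give G t x - give G x t = 1) ∨
      (G.degree t = 3 ∧ ¬ Bad G t ∧ 0 ≤ give G t x - give G x t ∧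
        (Bad G x → give G t x - give G x t = 1)) ∨
      (G.degree t = 3 ∧ Bad G t ∧ -1 ≤ give G t x - give G x t ∧
        (Bad G x → give G t x - give G x t = 0)) := by
    intro t _ h2
    have := d3 t
    unfold give
    rcases (by omega : G.degree t = 2 ∨ 4 ≤ G.degree t ∨ G.degree t = 3) with h | h | h
    · left; simp [h, hd]
    · right; left
      have hb : ¬ Bad G t := fun hb => by have := hb.1; omega
      simp [h, hd, hb]; omega
    · right; right
      by_cases hb : Bad G t
      · right
        by_cases hbx : Bad G x <;> simp [h, hd, hb, hbx]
      · left
        by_cases hbx : Bad G x <;> simp [h, hd, hb, hbx]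
  have na := net a hxa ta
  have nb := net b hxb tb
  have nc := net c hxc tc
  have e1 := f2 a b hxa hxb
  have e2 := f2 a c hxa hxc
  have e3 := f2 b a hxb hxa
  have e4 := f2 b c hxb hxc
  have e5 := f2 c a hxc hxa
  have e6 := f2 c b hxc hxb
  clear net f2 hsum hN d3 hxa hxb hxc hab hac hbc ta tb tc M hd
  generalize give G a x - give G x a = A at *
  generalize give G b x - give G x b = B at *
  generalize give G c x - give G x c = C at *
  push_cast
  rcases na with ⟨da, na⟩ | ⟨da, na⟩ | ⟨da, ba, na, na'⟩ | ⟨da, ba, na, na'⟩ <;>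
  rcases nb with ⟨db, nb⟩ | ⟨db, nb⟩ | ⟨db, bb, nb, nb'⟩ | ⟨db, bb, nb, nb'⟩ <;>
  rcases nc with ⟨dc, nc⟩ | ⟨dc, nc⟩ | ⟨dc, bc, nc, nc'⟩ | ⟨dc, bc, nc, nc'⟩ <;>
  first
    | omega
    | grind

lemma MinCE.final_two (M : MinCE G L D) {x : V} (hd : G.degree x = 2) :
    0 ≤ 3 * (G.degree x : ℤ) - 8 + ∑ u ∈ G.neighborFinset x, (give G u x - give G x u) := by
  have : ∑ u ∈ G.neighborFinset x, (give G u x - give G x u) = ∑ u ∈ G.neighborFinset x, 1 := by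
    refine Finset.sum_congr rfl fun u hu => ?_
    rw [mem_neighborFinset] at hu
    have h2 := M.two_le_degree u
    have h3 : G.degree u ≠ 2 := fun h => M.no_adj_two hu hd h
    unfold give
    by_cases h4 : 4 ≤ G.degree u
    · simp [hd, h4]
    · have : G.degree u = 3 := by omega
      simp [hd, this]
  rw [this, Finset.sum_const, card_neighborFinset_eq_degree, hd]
  norm_num

lemma MinCE.final_nonneg (M : MinCE G L D) (x : V) :
    0 ≤ 3 * (G.degree x : ℤ) - 8 + ∑ u ∈ G.neighborFinset x, (give G u x - give G x u) := by
  have h2 := M.two_le_degree x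
  rcases (by omega : G.degree x = 2 ∨ G.degree x = 3 ∨ 4 ≤ G.degree x) with h | h | h
  · exact M.final_two h
  · exact M.final_three h
  · have : ∑ u ∈ G.neighborFinset x, (-1 : ℤ) ≤
        ∑ u ∈ G.neighborFinset x, (give G u x - give G x u) := by
      refine Finset.sum_le_sum fun u _ => ?_
      have := give_nonneg (G := G) u x
      have := give_le_one (G := G) x u
      omega
    rw [Finset.sum_const, card_neighborFinset_eq_degree] at this
    simp only [smul_neg, nsmul_eq_mul, mul_one] at this
    omega

lemma MinCE.not_sparse (M : MinCE G L D) : 4 * Fintype.card V ≤ 3 * G.edgeFinset.card := by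
  have h0 : 0 ≤ ∑ x, (3 * (G.degree x : ℤ) - 8 +
      ∑ u ∈ G.neighborFinset x, (give G u x - give G x u)) :=
    Finset.sum_nonneg fun x _ => M.final_nonneg x
  have hz : ∑ x, ∑ u ∈ G.neighborFinset x, (give G u x - give G x u) = 0 := by
    have e : ∀ f : V → V → ℤ, ∑ x, ∑ u ∈ G.neighborFinset x, f x u =
        ∑ x, ∑ u, if G.Adj x u then f x u else 0 := by
      intro f
      refine Finset.sum_congr rfl fun x _ => ?_
      rw [← Finset.sum_filter]
      refine Finset.sum_congr ?_ fun _ _ => rfl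
      ext; simp
    simp only [Finset.sum_sub_distrib]
    rw [e, e, sub_eq_zero, Finset.sum_comm]
    simp only [G.adj_comm]
  rw [Finset.sum_add_distrib, hz, add_zero, Finset.sum_sub_distrib, ← Finset.mul_sum,
    ← Nat.cast_sum, G.sum_degrees_eq_twice_card_edges] at h0
  simp at h0
  omega

end Discharge

theorem exists_coloring (n : ℕ) : ∀ (V : Type) [Fintype V] [DecidableEq V] (G : SimpleGraph V)
    [DecidableRel G.Adj] (L : V → Finset ℕ) (D : ℕ), Fintype.card V = n → IsPlanar G →
    GirthEight G → 4 ≤ D → (∀ v, G.degree v ≤ D) → (∀ v, D + 3 ≤ (L v).card) →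
    ∃ φ : V → ℕ, IsTwoDistListColoring G L φ := by
  classical
  induction n using Nat.strong_induction_on with
  | _ n ih =>
  intro V _ _ G _ L D hn hpl hg hD hdeg hL
  by_contra hno
  have M : MinCE G L D := by
    refine ⟨hg, hD, hdeg, hL, ?_, hno⟩
    rintro S ⟨s, hs⟩
    let T : Set V := {v | v ∉ S}
    have hcard : Fintype.card T < n := by
      rw [← hn]
      exact Fintype.card_subtype_lt (p := fun v => v ∈ T) (x := s) (by simp [T, hs])
    have hpl' : IsPlanar (G.induce T) := by
      obtain ⟨f, hf, h1, h2⟩ := hpl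
      refine ⟨fun v => f v, hf.comp Subtype.val_injective, ?_, ?_⟩
      · intro u v w huv hw
        have := h1 (w := w.1) (show G.Adj u.1 v.1 from huv) hw
        simpa [Subtype.ext_iff] using this
      · intro u v x y huv hxy hne
        have hne' : s(u.1, v.1) ≠ s(x.1, y.1) := by
          intro h; apply hne
          simpa [Subtype.ext_iff] using h
        refine (h2 (show G.Adj u.1 v.1 from huv) (show G.Adj x.1 y.1 from hxy) hne').trans ?_
        rintro _ ⟨z, ⟨hz1, hz2⟩, rfl⟩
        have hzT : z ∈ T := by
          rcases hz1 with rfl | rfl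
          · exact u.2
          · exact v.2
        refine ⟨⟨z, hzT⟩, ⟨?_, ?_⟩, rfl⟩
        · simpa [Subtype.ext_iff] using hz1
        · simpa [Subtype.ext_iff] using hz2
    have hg' : GirthEight (G.induce T) := by
      intro v c hc
      have := hg _ (c.map (SimpleGraph.Embedding.induce T).toHom)
        (hc.map (f := (SimpleGraph.Embedding.induce (G := G) T).toHom)
          (SimpleGraph.Embedding.induce (G := G) T).injective)
      exact this.trans_eq (Walk.length_map _ _)
    have hdeg' : ∀ v, (G.induce T).degree v ≤ D := by
      intro v
      refine le_trans ?_ (hdeg v.1)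
      rw [← card_neighborFinset_eq_degree, ← card_neighborFinset_eq_degree]
      refine Finset.card_le_card_of_injOn Subtype.val ?_ Subtype.val_injective.injOn
      intro w hw
      simpa using hw
    obtain ⟨φ, hφ, hφ'⟩ := ih _ hcard T (G.induce T) (fun v => L v) D rfl hpl' hg' hD hdeg'
      (fun v => hL v)
    refine ⟨fun v => if h : v ∈ T then φ ⟨v, h⟩ else 0, ?_, ?_⟩
    · intro v hv
      have hv' : v ∈ T := hv
      simp only [hv', dif_pos]
      exact hφ ⟨v, hv'⟩
    · intro u v hu hv huv h
      have hu' : u ∈ T := hu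
      have hv' : v ∈ T := hv
      simp only [hu', hv', dif_pos]
      refine hφ' ⟨u, hu'⟩ ⟨v, hv'⟩ ⟨by simpa using huv, ?_⟩
      rcases h with h | ⟨w, hw, h1, h2⟩
      · exact Or.inl h
      · exact Or.inr ⟨⟨w, hw⟩, h1, h2⟩
  have hne : Nonempty V := by
    by_contra hemp
    rw [not_nonempty_iff] at hemp
    exact hno ⟨fun _ => 0, fun v => hemp.elim v, fun v => hemp.elim v⟩
  have h1 := sparse_of_planar hpl hg M.two_le_degree
  have h2 := M.not_sparse
  omega

/-- If `G` is planar with girth at least 8 (acyclic graphs have `egirth = ⊤`) and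
`Δ ≥ 4`, then `χ²ₗ(G) ≤ Δ + 3`. -/
theorem twoDist_choosable_of_planar_girth_eight
    {V : Type} [Fintype V] [DecidableEq V] (G : SimpleGraph V) [DecidableRel G.Adj]
    (hplanar : IsPlanar G) (hg : 8 ≤ G.egirth) (hΔ : 4 ≤ G.maxDegree) :
    ∀ L : V → Finset ℕ, (∀ v, G.maxDegree + 3 ≤ (L v).card) →
      ∃ φ : V → ℕ, IsTwoDistListColoring G L φ := by
  intro L hL
  refine exists_coloring _ V G L G.maxDegree rfl hplanar ?_ hΔ (G.degree_le_maxDegree) hL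
  intro v c hc
  have := (SimpleGraph.le_egirth.mp hg) v c hc
  exact_mod_cast this
end
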